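/- arXiv:1411.0915 — 2 statements merged into one kernel-verified Lean document; each statement's English description precedes it below -/
import Mathlib

section
/- Let λ be a compactly supported Borel probability measure on ℝ², let 0 < α < α' < 1/2, and suppose λ(B(x,δ)) ≤ C δ^{α'} for all x ∈ ℝ² and δ > 0. Fix 0 < r_0 < R_0 < ∞ and t ∈ [0,1), and define exponents by (1/p, 1/q, 1/s) = t(1/(1+2α), 1/(1+2α), (1−α)/(1+2α)) + (1−t)(1, 0, 1) (where 1/q = 0 means q = ∞ and the outer norm is the λ-essential supremum). Then there is a constant C' (depending on r_0, R_0, the diameter of the support of λ, C, and t) such that for every bounded Borel measurable function f on ℝ² with compact support: (∫_{ℝ²} (∫_{r_0}^{R_0} |Sf(x,r)|^s dr)^{q/s} dλ(x))^{1/q} ≤ C' ‖f‖_{L^p(ℝ²)}. -/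
open MeasureTheory Metric ENNReal

/-- The spherical average `Sf(x,r) = ∫_{S^{d-1}} f(x - rσ) dσ`, where the surface
measure on the unit sphere is realized as `(d-1)`-dimensional Hausdorff measure. -/
noncomputable def sphAvg {d : ℕ} (f : EuclideanSpace ℝ (Fin d) → ℝ)
    (x : EuclideanSpace ℝ (Fin d)) (r : ℝ) : ℝ :=
  ∫ σ in Metric.sphere (0 : EuclideanSpace ℝ (Fin d)) 1, f (x - r • σ) ∂(μH[(d : ℝ) - 1])

/-- The Euclidean plane. -/
abbrev Plane := EuclideanSpace ℝ (Fin 2)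

/-- The standard parametrization of the unit circle. -/
noncomputable def circlePt (θ : ℝ) : Plane := !₂[Real.cos θ, Real.sin θ]

theorem continuous_circlePt : Continuous circlePt := by
  unfold circlePt
  refine (PiLp.continuous_toLp 2 _).comp (continuous_pi fun i => ?_)
  fin_cases i
  · exact Real.continuous_cos
  · exact Real.continuous_sin

theorem norm_circlePt (θ : ℝ) : ‖circlePt θ‖ = 1 := by
  simp [circlePt, EuclideanSpace.norm_eq]

theorem lipschitzWith_circlePt : LipschitzWith 1 circlePt := by
  refine LipschitzWith.of_dist_le_mul fun a b => ?_
  rw [NNReal.coe_one, one_mul, EuclideanSpace.dist_eq, Real.dist_eq]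
  refine Real.sqrt_le_iff.2 ⟨abs_nonneg _, ?_⟩
  simp only [circlePt, Fin.sum_univ_two, Real.dist_eq, sq_abs]
  have h := Real.one_sub_sq_div_two_le_cos (x := a - b)
  rw [Real.cos_sub] at h
  simp
  nlinarith [Real.sin_sq_add_cos_sq a, Real.sin_sq_add_cos_sq b]

theorem exists_circlePt_eq {σ : Plane} (hσ : σ ∈ sphere (0 : Plane) 1) :
    ∃ θ ∈ Set.Ioc (-Real.pi) Real.pi, circlePt θ = σ := by
  have h : σ 0 ^ 2 + σ 1 ^ 2 = 1 := by
    have := mem_sphere_zero_iff_norm.1 hσ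
    rw [EuclideanSpace.norm_eq, Real.sqrt_eq_one] at this
    simpa [Fin.sum_univ_two] using this
  set z : ℂ := ⟨σ 0, σ 1⟩ with hz
  have hn : ‖z‖ = 1 := by
    rw [Complex.norm_def, Complex.normSq_mk, Real.sqrt_eq_one]
    linarith
  have hz0 : z ≠ 0 := by
    rintro h0
    simp [h0] at hn
  refine ⟨z.arg, Complex.arg_mem_Ioc z, ?_⟩
  have hc : Real.cos z.arg = σ 0 := by rw [Complex.cos_arg hz0, hn, div_one]
  have hs : Real.sin z.arg = σ 1 := by rw [Complex.sin_arg, hn, div_one]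
  ext i
  fin_cases i
  · simpa [circlePt] using hc
  · simpa [circlePt] using hs

theorem hausdorffMeasure_restrict_sphere_le :
    (μH[1] : Measure Plane).restrict (sphere 0 1) ≤
      (volume.restrict (Set.Ioo (-Real.pi) Real.pi)).map circlePt := by
  refine Measure.le_iff.2 fun A hA => ?_
  have hm : MeasurableSet (circlePt ⁻¹' A) := continuous_circlePt.measurable hA
  rw [Measure.restrict_apply hA, Measure.map_apply continuous_circlePt.measurable hA,
    Measure.restrict_congr_set Ioo_ae_eq_Ioc, Measure.restrict_apply hm]
  have hsub : A ∩ sphere 0 1 ⊆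
      circlePt '' (circlePt ⁻¹' A ∩ Set.Ioc (-Real.pi) Real.pi) := by
    rintro σ ⟨hσA, hσ⟩
    obtain ⟨θ, hθ, rfl⟩ := exists_circlePt_eq hσ
    exact ⟨θ, ⟨hσA, hθ⟩, rfl⟩
  refine (measure_mono hsub).trans ?_
  refine (lipschitzWith_circlePt.hausdorffMeasure_image_le zero_le_one _).trans ?_
  simp [hausdorffMeasure_real]

theorem lintegral_plane_eq_polar {F : Plane → ℝ≥0∞} (hF : Measurable F) :
    ∫⁻ y, F y = ∫⁻ r in Set.Ioi (0 : ℝ), ∫⁻ θ in Set.Ioo (-Real.pi) Real.pi,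
      ENNReal.ofReal r * F (r • circlePt θ) := by
  have e := ((volume_preserving_finTwoArrow ℝ).symm).trans
    (EuclideanSpace.volume_preserving_symm_measurableEquiv_toLp (Fin 2)).symm
  have hms : Measurable fun p : ℝ × ℝ =>
      ENNReal.ofReal p.1 * F (p.1 • circlePt p.2) :=
    (ENNReal.measurable_ofReal.comp measurable_fst).mul
      (hF.comp (measurable_fst.smul (continuous_circlePt.measurable.comp measurable_snd)))
  rw [← e.lintegral_comp hF, ← lintegral_comp_polarCoord_symm]
  rw [polarCoord_target, Measure.volume_eq_prod, ← Measure.prod_restrict,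
    lintegral_prod _ ?_]
  · refine lintegral_congr fun r => lintegral_congr fun θ => ?_
    rw [smul_eq_mul]
    congr 2
    ext i
    fin_cases i <;> simp [circlePt, polarCoord_symm_apply]
  · convert hms.aemeasurable using 3 with p
    congr 2
    ext i
    fin_cases i <;> simp [circlePt, polarCoord_symm_apply]

/-- The circular average of a nonnegative function. -/
noncomputable def circAvg (f : Plane → ℝ≥0∞) (x : Plane) (r : ℝ) : ℝ≥0∞ :=
  ∫⁻ θ in Set.Ioo (-Real.pi) Real.pi, f (x - r • circlePt θ)

theorem measurable_circAvg {f : Plane → ℝ≥0∞} (hf : Measurable f) :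
    Measurable fun z : Plane × ℝ => circAvg f z.1 z.2 := by
  unfold circAvg
  refine Measurable.lintegral_prod_right'
    (f := fun w : (Plane × ℝ) × ℝ => f (w.1.1 - w.1.2 • circlePt w.2)) ?_
  refine hf.comp (measurable_fst.fst.sub (measurable_fst.snd.smul ?_))
  exact continuous_circlePt.measurable.comp measurable_snd

theorem lintegral_radial_mul {φ : ℝ → ℝ≥0∞} (hφ : Measurable φ) {f : Plane → ℝ≥0∞}
    (hf : Measurable f) (x : Plane) :
    ∫⁻ y, φ ‖x - y‖ * f y =
      ∫⁻ r in Set.Ioi (0 : ℝ), ENNReal.ofReal r * (φ r * circAvg f x r) := by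
  rw [← lintegral_sub_left_eq_self _ x, lintegral_plane_eq_polar]
  · refine setLIntegral_congr_fun measurableSet_Ioi fun r hr => ?_
    have hr' : 0 < r := hr
    have hn (θ : ℝ) : ‖x - (x - r • circlePt θ)‖ = r := by
      rw [sub_sub_cancel x (r • circlePt θ), norm_smul, norm_circlePt, mul_one,
          Real.norm_of_nonneg hr'.le]
    simp only [hn]
    have hm : Measurable fun θ => f (x - r • circlePt θ) :=
      hf.comp ((continuous_circlePt.const_smul r).measurable.const_sub x)
    rw [lintegral_const_mul _ (hm.const_mul _), lintegral_const_mul _ hm]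
    rfl
  · exact (hφ.comp (by fun_prop)).mul (hf.comp (measurable_id.const_sub x))

theorem enorm_sphAvg_le {f : Plane → ℝ} (hf : Measurable f) (x : Plane) (r : ℝ) :
    ‖sphAvg f x r‖ₑ ≤ circAvg (fun y => ‖f y‖ₑ) x r := by
  unfold sphAvg circAvg
  have h1 : (((2 : ℕ) : ℝ) - 1) = 1 := by norm_num
  rw [h1]
  refine (enorm_integral_le_lintegral_enorm _).trans ?_
  refine (lintegral_mono' hausdorffMeasure_restrict_sphere_le le_rfl).trans ?_
  rw [lintegral_map (f := fun σ => ‖f (x - r • σ)‖ₑ) (hf.comp (by fun_prop)).enorm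
    continuous_circlePt.measurable]

theorem lintegral_comp_abs_eq {G : ℝ → ℝ≥0∞} (hG : Measurable G) :
    ∫⁻ v : ℝ, G |v| = 2 * ∫⁻ v in Set.Ioi (0 : ℝ), G v := by
  have h1 : ∫⁻ v in Set.Ioi (0 : ℝ), G |v| = ∫⁻ v in Set.Ioi (0 : ℝ), G v :=
    setLIntegral_congr_fun measurableSet_Ioi fun v hv => by
      simp only [abs_of_pos (Set.mem_Ioi.1 hv)]
  have h2 : ∫⁻ v in (Set.Ioi (0 : ℝ))ᶜ, G |v| = ∫⁻ v in Set.Ioi (0 : ℝ), G |v| := by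
    rw [Set.compl_Ioi, setLIntegral_congr Iio_ae_eq_Iic.symm,
      ← (Measure.measurePreserving_neg (volume : Measure ℝ)).setLIntegral_comp_preimage
        measurableSet_Ioi (f := fun v => G |v|) (hG.comp measurable_norm)]
    simp
  rw [← lintegral_add_compl _ measurableSet_Ioi, h2, h1, two_mul]

/-- The kernel `|v|^(-1/2)` on the line. -/
noncomputable def invSqrt (v : ℝ) : ℝ≥0∞ := ENNReal.ofReal (|v| ^ (-(1 / 2) : ℝ))

theorem measurable_invSqrt : Measurable invSqrt := by
  unfold invSqrt
  fun_prop

theorem invSqrt_neg (v : ℝ) : invSqrt (-v) = invSqrt v := by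
  simp [invSqrt]

theorem setLIntegral_invSqrt_near (c : ℝ) {L : ℝ} (hL : 0 < L) :
    ∫⁻ r in {r : ℝ | |r - c| < L}, invSqrt (r - c) = ENNReal.ofReal (4 * L ^ (1 / 2 : ℝ)) := by
  have hG : Measurable ((Set.Iio L).indicator fun v : ℝ => ENNReal.ofReal (v ^ (-(1 / 2) : ℝ))) :=
    Measurable.indicator (by fun_prop) measurableSet_Iio
  have hm : MeasurableSet {r : ℝ | |r - c| < L} := measurableSet_lt (by fun_prop) (by fun_prop)
  calc
    _ = ∫⁻ r : ℝ, (Set.Iio L).indicator (fun v : ℝ => ENNReal.ofReal (v ^ (-(1 / 2) : ℝ)))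
          |r - c| := by
        rw [← lintegral_indicator hm]
        rfl
    _ = ∫⁻ r : ℝ, (Set.Iio L).indicator (fun v : ℝ => ENNReal.ofReal (v ^ (-(1 / 2) : ℝ)))
          |r| :=
        lintegral_sub_right_eq_self
          (fun r => (Set.Iio L).indicator (fun v => ENNReal.ofReal (v ^ (-(1 / 2) : ℝ))) |r|) c
    _ = 2 * ENNReal.ofReal (2 * L ^ (1 / 2 : ℝ)) := by
        rw [lintegral_comp_abs_eq hG, setLIntegral_indicator measurableSet_Iio,
          Set.inter_comm, Set.Ioi_inter_Iio, setLIntegral_congr Ioo_ae_eq_Ioc]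
        congr 1
        have hi : IntervalIntegrable (fun v : ℝ => v ^ (-(1 / 2) : ℝ)) volume 0 L :=
          intervalIntegral.intervalIntegrable_rpow' (by norm_num)
        rw [← ofReal_integral_eq_lintegral_ofReal
          ((intervalIntegrable_iff_integrableOn_Ioc_of_le hL.le).1 hi),
          ← intervalIntegral.integral_of_le hL.le, integral_rpow (Or.inl (by norm_num))]
        · congr 1
          rw [show (-(1 / 2) + 1 : ℝ) = 1 / 2 by norm_num, Real.zero_rpow (by norm_num)]
          ring
        · exact (ae_restrict_iff' measurableSet_Ioc).2
            (.of_forall fun v hv => Real.rpow_nonneg hv.1.le _)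
    _ = _ := by
        rw [show (2 : ℝ≥0∞) = ENNReal.ofReal 2 by simp, ← ENNReal.ofReal_mul (by norm_num)]
        congr 1
        ring

theorem setLIntegral_invSqrt_far (c : ℝ) {L : ℝ} (hL : 0 < L) :
    ∫⁻ r in {r : ℝ | L < |r - c|}, invSqrt (r - c) ^ (4 : ℝ) = ENNReal.ofReal (2 * L⁻¹) := by
  have hG : Measurable ((Set.Ioi L).indicator fun v : ℝ => ENNReal.ofReal (v ^ (-2 : ℝ))) :=
    Measurable.indicator (by fun_prop) measurableSet_Ioi
  have hm : MeasurableSet {r : ℝ | L < |r - c|} := measurableSet_lt (by fun_prop) (by fun_prop)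
  calc
    _ = ∫⁻ r : ℝ, (Set.Ioi L).indicator (fun v : ℝ => ENNReal.ofReal (v ^ (-2 : ℝ)))
          |r - c| := by
        rw [← lintegral_indicator hm]
        refine lintegral_congr fun r => ?_
        by_cases h : L < |r - c|
        · rw [Set.indicator_of_mem (show r ∈ {r : ℝ | L < |r - c|} from h),
            Set.indicator_of_mem (Set.mem_Ioi.2 h), invSqrt,
            ENNReal.ofReal_rpow_of_pos (Real.rpow_pos_of_pos (hL.trans h) _),
            ← Real.rpow_mul (abs_nonneg _)]
          norm_num
        · rw [Set.indicator_of_notMem (show r ∉ {r : ℝ | L < |r - c|} from h),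
            Set.indicator_of_notMem (by simpa using h)]
    _ = ∫⁻ r : ℝ, (Set.Ioi L).indicator (fun v : ℝ => ENNReal.ofReal (v ^ (-2 : ℝ)))
          |r| :=
        lintegral_sub_right_eq_self
          (fun r => (Set.Ioi L).indicator (fun v => ENNReal.ofReal (v ^ (-2 : ℝ))) |r|) c
    _ = 2 * ENNReal.ofReal L⁻¹ := by
        rw [lintegral_comp_abs_eq hG, setLIntegral_indicator measurableSet_Ioi,
          Set.inter_eq_left.2 (Set.Ioi_subset_Ioi hL.le)]
        congr 1
        rw [← ofReal_integral_eq_lintegral_ofReal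
          (integrableOn_Ioi_rpow_of_lt (by norm_num) hL),
          integral_Ioi_rpow_of_lt (by norm_num) hL]
        · congr 1
          norm_num [Real.rpow_neg_one]
        · exact (ae_restrict_iff' measurableSet_Ioi).2
            (.of_forall fun v hv => Real.rpow_nonneg (hL.trans hv).le _)
    _ = _ := by
        rw [show (2 : ℝ≥0∞) = ENNReal.ofReal 2 by simp, ← ENNReal.ofReal_mul (by norm_num)]

/-- Truncated potential estimate behind the Hardy-Littlewood-Sobolev inequality. -/
theorem setLIntegral_mul_invSqrt_le {h : ℝ → ℝ≥0∞} (hh : Measurable h)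
    (h1 : ∫⁻ r, h r ^ (4 / 3 : ℝ) ≤ 1) (c : ℝ) (M : ℝ≥0∞) :
    ∫⁻ r in {r | h r ≤ M}, h r * invSqrt (r - c) ≤ 6 * M ^ (1 / 3 : ℝ) := by
  rcases eq_or_ne M ⊤ with rfl | hM
  · simp [ENNReal.top_rpow_of_pos, ENNReal.mul_top]
  have hset : MeasurableSet {r | h r ≤ M} := measurableSet_le hh measurable_const
  rcases eq_or_ne M 0 with rfl | hM0
  · rw [setLIntegral_congr_fun (g := fun _ => 0) hset fun r (hr : h r ≤ 0) => by
      simp [nonpos_iff_eq_zero.1 hr]]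
    simp
  lift M to NNReal using hM
  set m : ℝ := (M : ℝ)
  have hm : 0 < m := by
    simpa [m, pos_iff_ne_zero] using hM0
  have hMm : (M : ℝ≥0∞) = ENNReal.ofReal m := by simp [m]
  have hk : Measurable fun r => invSqrt (r - c) := measurable_invSqrt.comp (by fun_prop)
  set L : ℝ := m ^ (-(4 / 3) : ℝ) with hLdef
  have hL : 0 < L := Real.rpow_pos_of_pos hm _
  have hnear : ∫⁻ r in {r : ℝ | |r - c| < L}, (M : ℝ≥0∞) * invSqrt (r - c) =
      ENNReal.ofReal (4 * m ^ (1 / 3 : ℝ)) := by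
    rw [lintegral_const_mul _ hk, setLIntegral_invSqrt_near c hL, hMm,
      ← ENNReal.ofReal_mul hm.le, hLdef, ← Real.rpow_mul hm.le]
    congr 1
    rw [mul_left_comm]
    nth_rw 1 [← Real.rpow_one m]
    rw [← Real.rpow_add hm]
    norm_num
  have hfar : ∫⁻ r in {r : ℝ | L < |r - c|}, h r * invSqrt (r - c) ≤
      ENNReal.ofReal (2 * m ^ (1 / 3 : ℝ)) := by
    calc
      _ = ∫⁻ r in {r : ℝ | L < |r - c|}, (h r ^ (4 / 3 : ℝ)) ^ (3 / 4 : ℝ) *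
            (invSqrt (r - c) ^ (4 : ℝ)) ^ (1 / 4 : ℝ) := by
          simp_rw [← ENNReal.rpow_mul]
          norm_num
      _ ≤ (∫⁻ r in {r : ℝ | L < |r - c|}, h r ^ (4 / 3 : ℝ)) ^ (3 / 4 : ℝ) *
            (∫⁻ r in {r : ℝ | L < |r - c|}, invSqrt (r - c) ^ (4 : ℝ)) ^ (1 / 4 : ℝ) :=
          ENNReal.lintegral_mul_norm_pow_le (hh.pow_const _).aemeasurable
            (hk.pow_const _).aemeasurable (by norm_num) (by norm_num) (by norm_num)
      _ ≤ 1 ^ (3 / 4 : ℝ) * ENNReal.ofReal (2 * L⁻¹) ^ (1 / 4 : ℝ) := by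
          rw [setLIntegral_invSqrt_far c hL]
          gcongr
          exact (setLIntegral_le_lintegral _ _).trans h1
      _ ≤ ENNReal.ofReal (2 * m ^ (1 / 3 : ℝ)) := by
          rw [ENNReal.one_rpow, one_mul, ENNReal.ofReal_rpow_of_pos (by positivity)]
          refine ENNReal.ofReal_le_ofReal ?_
          rw [Real.mul_rpow (by norm_num) (by positivity), hLdef, ← Real.rpow_neg hm.le,
            ← Real.rpow_mul hm.le]
          norm_num
          refine mul_le_mul_of_nonneg_right ?_ (by positivity)
          calc (2 : ℝ) ^ (1 / 4 : ℝ) ≤ 2 ^ (1 : ℝ) :=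
                Real.rpow_le_rpow_of_exponent_le (by norm_num) (by norm_num)
            _ = 2 := by norm_num
  have hfin : (6 : ℝ≥0∞) * (M : ℝ≥0∞) ^ (1 / 3 : ℝ) =
      ENNReal.ofReal (4 * m ^ (1 / 3 : ℝ)) + ENNReal.ofReal (2 * m ^ (1 / 3 : ℝ)) := by
    rw [← ENNReal.ofReal_add (by positivity) (by positivity), hMm,
      ENNReal.ofReal_rpow_of_pos hm, show (6 : ℝ≥0∞) = ENNReal.ofReal 6 by simp,
      ← ENNReal.ofReal_mul (by norm_num)]
    congr 1
    ring
  have hnull : volume {r : ℝ | |r - c| = L} = 0 := by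
    refine measure_mono_null (t := {c + L, c - L}) (fun r hr => ?_)
      (Set.Finite.measure_zero (by simp) _)
    rcases eq_or_eq_neg_of_abs_eq (hr : |r - c| = L) with h | h
    · left; linarith
    · right; simp only [Set.mem_singleton_iff]; linarith
  rw [hfin, ← hnear]
  calc
    _ ≤ ∫⁻ r in ({r : ℝ | |r - c| < L} ∪ {r : ℝ | L < |r - c|}) ∪ {r : ℝ | |r - c| = L},
          min (h r) M * invSqrt (r - c) := by
        have hu : ({r : ℝ | |r - c| < L} ∪ {r : ℝ | L < |r - c|}) ∪ {r : ℝ | |r - c| = L} =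
            Set.univ := by
          ext r
          rcases lt_trichotomy (|r - c|) L with h | h | h <;> simp [h]
        rw [hu, Measure.restrict_univ, ← lintegral_indicator hset]
        refine lintegral_mono fun r => ?_
        by_cases hr : h r ≤ M
        · rw [Set.indicator_of_mem (show r ∈ {r | h r ≤ M} from hr), min_eq_left hr]
        · rw [Set.indicator_of_notMem (show r ∉ {r | h r ≤ M} from hr)]
          exact zero_le
    _ ≤ _ := by
        refine (lintegral_union_le _ _ _).trans ?_
        rw [setLIntegral_measure_zero _ _ hnull, add_zero]
        refine (lintegral_union_le _ _ _).trans ?_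
        gcongr
        · exact min_le_right _ _
        · refine le_trans ?_ hfar
          gcongr
          exact min_le_left _ _

/-- A Hardy-Littlewood-Sobolev inequality for kernels which are translates of `|v|^(-1/2)` in
each variable, for normalized functions. -/
theorem lintegral_mul_kernel_le_of_le_one {h₁ h₂ : ℝ → ℝ≥0∞} (hh₁ : Measurable h₁)
    (hh₂ : Measurable h₂) (hn₁ : ∫⁻ r, h₁ r ^ (4 / 3 : ℝ) ≤ 1)
    (hn₂ : ∫⁻ r, h₂ r ^ (4 / 3 : ℝ) ≤ 1) {κ : ℝ → ℝ → ℝ≥0∞}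
    (hκ : Measurable (Function.uncurry κ))
    (hκ₁ : ∀ b, ∃ c, ∀ a, κ a b = invSqrt (a - c))
    (hκ₂ : ∀ a, ∃ c, ∀ b, κ a b = invSqrt (b - c)) :
    ∫⁻ a, ∫⁻ b, h₁ a * h₂ b * κ a b ≤ 12 := by
  have hpow (z : ℝ≥0∞) : z * (6 * z ^ (1 / 3 : ℝ)) = 6 * z ^ (4 / 3 : ℝ) := by
    rw [mul_left_comm]
    nth_rw 1 [← ENNReal.rpow_one z]
    rw [← ENNReal.rpow_add_of_nonneg _ _ (by norm_num) (by norm_num)]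
    norm_num
  have hk (c : ℝ) : Measurable fun a => invSqrt (a - c) := measurable_invSqrt.comp (by fun_prop)
  have hA : ∫⁻ a, ∫⁻ b in {b | h₂ b ≤ h₁ a}, h₁ a * h₂ b * κ a b ≤ 6 := by
    calc
      _ ≤ ∫⁻ a, 6 * h₁ a ^ (4 / 3 : ℝ) := by
          refine lintegral_mono fun a => ?_
          obtain ⟨c, hc⟩ := hκ₂ a
          simp only [hc, mul_assoc]
          rw [lintegral_const_mul _ (f := fun v => h₂ v * invSqrt (v - c)) (hh₂.mul (hk c)), ← hpow]
          gcongr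
          exact setLIntegral_mul_invSqrt_le hh₂ hn₂ c _
      _ ≤ 6 := by
          rw [lintegral_const_mul _ (hh₁.pow_const _)]
          exact (mul_le_mul_right hn₁ 6).trans (by simp)
  have hB : ∫⁻ b, ∫⁻ a in {a | h₁ a ≤ h₂ b}, h₁ a * h₂ b * κ a b ≤ 6 := by
    calc
      _ ≤ ∫⁻ b, 6 * h₂ b ^ (4 / 3 : ℝ) := by
          refine lintegral_mono fun b => ?_
          obtain ⟨c, hc⟩ := hκ₁ b
          simp only [hc, mul_assoc, mul_left_comm _ (h₂ b)]
          rw [lintegral_const_mul _ (f := fun v => h₁ v * invSqrt (v - c)) (hh₁.mul (hk c)), ← hpow]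
          gcongr
          exact setLIntegral_mul_invSqrt_le hh₁ hn₁ c _
      _ ≤ 6 := by
          rw [lintegral_const_mul _ (hh₂.pow_const _)]
          exact (mul_le_mul_right hn₂ 6).trans (by simp)
  have hm : Measurable fun z : ℝ × ℝ => h₁ z.1 * h₂ z.2 * κ z.1 z.2 :=
    ((hh₁.comp measurable_fst).mul (hh₂.comp measurable_snd)).mul hκ
  have hs : MeasurableSet {z : ℝ × ℝ | h₁ z.1 ≤ h₂ z.2} :=
    measurableSet_le (hh₁.comp measurable_fst) (hh₂.comp measurable_snd)
  have hBswap : ∫⁻ a, ∫⁻ b in {b | h₁ a ≤ h₂ b}, h₁ a * h₂ b * κ a b =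
      ∫⁻ b, ∫⁻ a in {a | h₁ a ≤ h₂ b}, h₁ a * h₂ b * κ a b := by
    have e1 (a : ℝ) : ∫⁻ b in {b | h₁ a ≤ h₂ b}, h₁ a * h₂ b * κ a b =
        ∫⁻ b, {z : ℝ × ℝ | h₁ z.1 ≤ h₂ z.2}.indicator
          (fun z => h₁ z.1 * h₂ z.2 * κ z.1 z.2) (a, b) := by
      rw [← lintegral_indicator (measurableSet_le measurable_const hh₂)]
      rfl
    have e2 (b : ℝ) : ∫⁻ a in {a | h₁ a ≤ h₂ b}, h₁ a * h₂ b * κ a b =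
        ∫⁻ a, {z : ℝ × ℝ | h₁ z.1 ≤ h₂ z.2}.indicator
          (fun z => h₁ z.1 * h₂ z.2 * κ z.1 z.2) (a, b) := by
      rw [← lintegral_indicator (measurableSet_le hh₁ measurable_const)]
      rfl
    simp_rw [e1, e2]
    exact lintegral_lintegral_swap (hm.indicator hs).aemeasurable
  calc
    _ ≤ ∫⁻ a, ((∫⁻ b in {b | h₂ b ≤ h₁ a}, h₁ a * h₂ b * κ a b) +
          ∫⁻ b in {b | h₁ a ≤ h₂ b}, h₁ a * h₂ b * κ a b) := by
        refine lintegral_mono fun a => ?_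
        refine le_trans ?_ (lintegral_union_le _ _ _)
        have hu : {b | h₂ b ≤ h₁ a} ∪ {b | h₁ a ≤ h₂ b} = Set.univ := by
          ext b
          simpa using le_total _ _
        rw [hu, Measure.restrict_univ]
    _ = (∫⁻ a, ∫⁻ b in {b | h₂ b ≤ h₁ a}, h₁ a * h₂ b * κ a b) +
          ∫⁻ a, ∫⁻ b in {b | h₁ a ≤ h₂ b}, h₁ a * h₂ b * κ a b := by
        refine lintegral_add_right _ ?_
        have e1 (a : ℝ) : ∫⁻ b in {b | h₁ a ≤ h₂ b}, h₁ a * h₂ b * κ a b =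
            ∫⁻ b, {z : ℝ × ℝ | h₁ z.1 ≤ h₂ z.2}.indicator
              (fun z => h₁ z.1 * h₂ z.2 * κ z.1 z.2) (a, b) := by
          rw [← lintegral_indicator (measurableSet_le measurable_const hh₂)]
          rfl
        simp_rw [e1]
        exact (hm.indicator hs).lintegral_prod_right'
    _ ≤ 6 + 6 := by
        rw [hBswap]
        gcongr
    _ = 12 := by norm_num

/-- A Hardy-Littlewood-Sobolev inequality for kernels which are translates of `|v|^(-1/2)` in
each variable. -/
theorem lintegral_mul_kernel_le {h₁ h₂ : ℝ → ℝ≥0∞} (hh₁ : Measurable h₁)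
    (hh₂ : Measurable h₂) {κ : ℝ → ℝ → ℝ≥0∞} (hκ : Measurable (Function.uncurry κ))
    (hκ₁ : ∀ b, ∃ c, ∀ a, κ a b = invSqrt (a - c))
    (hκ₂ : ∀ a, ∃ c, ∀ b, κ a b = invSqrt (b - c)) :
    ∫⁻ a, ∫⁻ b, h₁ a * h₂ b * κ a b ≤ 12 * ((∫⁻ r, h₁ r ^ (4 / 3 : ℝ)) ^ (3 / 4 : ℝ) *
      (∫⁻ r, h₂ r ^ (4 / 3 : ℝ)) ^ (3 / 4 : ℝ)) := by
  have hzero {h : ℝ → ℝ≥0∞} (hh : Measurable h) (h0 : ∫⁻ r, h r ^ (4 / 3 : ℝ) = 0) :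
      h =ᵐ[volume] 0 := by
    filter_upwards [(lintegral_eq_zero_iff (hh.pow_const _)).1 h0] with r hr
    exact (ENNReal.rpow_eq_zero_iff_of_pos (by norm_num)).1 hr
  set N₁ := (∫⁻ r, h₁ r ^ (4 / 3 : ℝ)) ^ (3 / 4 : ℝ) with hN₁
  set N₂ := (∫⁻ r, h₂ r ^ (4 / 3 : ℝ)) ^ (3 / 4 : ℝ) with hN₂
  rcases eq_or_ne N₁ 0 with h0 | h0
  · have hz := hzero hh₁ ((ENNReal.rpow_eq_zero_iff_of_pos (by norm_num)).1 h0)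
    rw [lintegral_congr_ae (g := fun _ => 0) (hz.mono fun a ha => by simp [ha])]
    simp
  rcases eq_or_ne N₂ 0 with h0' | h0'
  · have hz := hzero hh₂ ((ENNReal.rpow_eq_zero_iff_of_pos (by norm_num)).1 h0')
    rw [lintegral_congr (g := fun _ => 0) fun a => by
      rw [lintegral_congr_ae (g := fun _ => 0) (hz.mono fun b hb => by simp [hb])]
      simp]
    simp
  rcases eq_or_ne N₁ ⊤ with ht | ht
  · simp [ht, h0', ENNReal.mul_top]
  rcases eq_or_ne N₂ ⊤ with ht' | ht'
  · simp [ht', h0, ENNReal.mul_top]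
  have hnorm {h : ℝ → ℝ≥0∞} (hh : Measurable h) {N : ℝ≥0∞}
      (hN : N = (∫⁻ r, h r ^ (4 / 3 : ℝ)) ^ (3 / 4 : ℝ)) (hN0 : N ≠ 0) (hNt : N ≠ ⊤) :
      ∫⁻ r, (N⁻¹ * h r) ^ (4 / 3 : ℝ) ≤ 1 := by
    have hN' : ∫⁻ r, h r ^ (4 / 3 : ℝ) = N ^ (4 / 3 : ℝ) := by
      rw [hN, ← ENNReal.rpow_mul]
      norm_num
    simp_rw [ENNReal.mul_rpow_of_nonneg _ _ (show (0 : ℝ) ≤ 4 / 3 by norm_num)]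
    rw [lintegral_const_mul _ (hh.pow_const _), hN', ← ENNReal.mul_rpow_of_nonneg _ _ (by norm_num),
      ENNReal.inv_mul_cancel hN0 hNt, ENNReal.one_rpow]
  have key := lintegral_mul_kernel_le_of_le_one (hh₁.const_mul N₁⁻¹) (hh₂.const_mul N₂⁻¹)
    (hnorm hh₁ hN₁ h0 ht) (hnorm hh₂ hN₂ h0' ht') hκ hκ₁ hκ₂
  have hm : Measurable fun z : ℝ × ℝ => (N₁⁻¹ * h₁ z.1) * (N₂⁻¹ * h₂ z.2) * κ z.1 z.2 :=
    (((hh₁.comp measurable_fst).const_mul _).mul ((hh₂.comp measurable_snd).const_mul _)).mul hκ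
  calc
    _ = ∫⁻ a, ∫⁻ b, (N₁ * N₂) * ((N₁⁻¹ * h₁ a) * (N₂⁻¹ * h₂ b) * κ a b) := by
        refine lintegral_congr fun a => lintegral_congr fun b => ?_
        calc h₁ a * h₂ b * κ a b = (N₁ * N₁⁻¹) * (N₂ * N₂⁻¹) * (h₁ a * h₂ b * κ a b) := by
              rw [ENNReal.mul_inv_cancel h0 ht, ENNReal.mul_inv_cancel h0' ht', one_mul, one_mul]
          _ = _ := by ring
    _ = (N₁ * N₂) * ∫⁻ a, ∫⁻ b, (N₁⁻¹ * h₁ a) * (N₂⁻¹ * h₂ b) * κ a b := by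
        rw [← lintegral_const_mul _ hm.lintegral_prod_right']
        refine lintegral_congr fun a => ?_
        exact lintegral_const_mul _ (hm.comp measurable_prodMk_left)
    _ ≤ (N₁ * N₂) * 12 := by gcongr
    _ = _ := mul_comm _ _

/-- The kernel governing the intersection of thin annuli whose centres are at distance `d`. -/
noncomputable def annulusKernel (d a b : ℝ) : ℝ≥0∞ :=
  invSqrt (a - b - d) + invSqrt (a - b + d) + invSqrt (a + b - d)

theorem measurable_annulusKernel (d a : ℝ) : Measurable (annulusKernel d a) :=
  ((measurable_invSqrt.comp (by fun_prop)).add (measurable_invSqrt.comp (by fun_prop))).add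
    (measurable_invSqrt.comp (by fun_prop))

theorem lintegral_mul_annulusKernel_le {h₁ h₂ : ℝ → ℝ≥0∞} (hh₁ : Measurable h₁)
    (hh₂ : Measurable h₂) (d : ℝ) :
    ∫⁻ a, ∫⁻ b, h₁ a * h₂ b * annulusKernel d a b ≤
      36 * ((∫⁻ r, h₁ r ^ (4 / 3 : ℝ)) ^ (3 / 4 : ℝ) *
        (∫⁻ r, h₂ r ^ (4 / 3 : ℝ)) ^ (3 / 4 : ℝ)) := by
  have m₁ : Measurable fun z : ℝ × ℝ => invSqrt (z.1 - z.2 - d) :=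
    measurable_invSqrt.comp (by fun_prop)
  have m₂ : Measurable fun z : ℝ × ℝ => invSqrt (z.1 - z.2 + d) :=
    measurable_invSqrt.comp (by fun_prop)
  have m₃ : Measurable fun z : ℝ × ℝ => invSqrt (z.1 + z.2 - d) :=
    measurable_invSqrt.comp (by fun_prop)
  have hh : Measurable fun z : ℝ × ℝ => h₁ z.1 * h₂ z.2 :=
    (hh₁.comp measurable_fst).mul (hh₂.comp measurable_snd)
  have mm₂ : Measurable fun z : ℝ × ℝ => h₁ z.1 * h₂ z.2 * invSqrt (z.1 - z.2 + d) := hh.mul m₂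
  have mm₃ : Measurable fun z : ℝ × ℝ => h₁ z.1 * h₂ z.2 * invSqrt (z.1 + z.2 - d) := hh.mul m₃
  have k₁ := lintegral_mul_kernel_le hh₁ hh₂ (κ := fun a b => invSqrt (a - b - d)) m₁
    (fun b => ⟨b + d, fun a => by ring_nf⟩)
    (fun a => ⟨a - d, fun b => by rw [← invSqrt_neg]; ring_nf⟩)
  have k₂ := lintegral_mul_kernel_le hh₁ hh₂ (κ := fun a b => invSqrt (a - b + d)) m₂
    (fun b => ⟨b - d, fun a => by ring_nf⟩)
    (fun a => ⟨a + d, fun b => by rw [← invSqrt_neg]; ring_nf⟩)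
  have k₃ := lintegral_mul_kernel_le hh₁ hh₂ (κ := fun a b => invSqrt (a + b - d)) m₃
    (fun b => ⟨d - b, fun a => by ring_nf⟩)
    (fun a => ⟨d - a, fun b => by ring_nf⟩)
  set N := (∫⁻ r, h₁ r ^ (4 / 3 : ℝ)) ^ (3 / 4 : ℝ) * (∫⁻ r, h₂ r ^ (4 / 3 : ℝ)) ^ (3 / 4 : ℝ)
  have e : ∫⁻ a, ∫⁻ b, h₁ a * h₂ b * annulusKernel d a b =
      (∫⁻ a, ∫⁻ b, h₁ a * h₂ b * invSqrt (a - b - d)) +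
      (∫⁻ a, ∫⁻ b, h₁ a * h₂ b * invSqrt (a - b + d)) +
      ∫⁻ a, ∫⁻ b, h₁ a * h₂ b * invSqrt (a + b - d) := by
    rw [← lintegral_add_right _ mm₂.lintegral_prod_right',
      ← lintegral_add_right _ mm₃.lintegral_prod_right']
    refine lintegral_congr fun a => ?_
    have ma₂ : Measurable fun b => h₁ a * h₂ b * invSqrt (a - b + d) :=
      mm₂.comp measurable_prodMk_left
    have ma₃ : Measurable fun b => h₁ a * h₂ b * invSqrt (a + b - d) :=
      mm₃.comp measurable_prodMk_left
    rw [← lintegral_add_right _ ma₂, ← lintegral_add_right _ ma₃]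
    simp only [annulusKernel, mul_add]
  rw [e]
  calc
    _ ≤ 12 * N + 12 * N + 12 * N := add_le_add (add_le_add k₁ k₂) k₃
    _ = 36 * N := by ring

theorem invSqrt_eq (v : ℝ) : invSqrt v = ENNReal.ofReal (√|v|)⁻¹ := by
  rw [invSqrt, Real.rpow_neg (abs_nonneg _), Real.sqrt_eq_rpow]

/-- The constant in the estimate for the bipolar Jacobian. -/
noncomputable def bipolarConst (r₀ R₀ : ℝ) : ℝ := 2 * R₀ * √(2 * R₀) / (r₀ * √r₀)

theorem one_le_bipolar {r₀ R₀ r ρ d : ℝ} (hr₀ : 0 < r₀) (hr : r ∈ Set.Ioc r₀ R₀)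
    (hρ : ρ ∈ Set.Ioc r₀ R₀) (hA : 0 < r + d - ρ) (hB : 0 < ρ - r + d) (hC : 0 < r + ρ - d) :
    1 ≤ bipolarConst r₀ R₀ * (√d)⁻¹ *
      ((√(r + d - ρ))⁻¹ + (√(ρ - r + d))⁻¹ + (√(r + ρ - d))⁻¹) *
      (√((r + d - ρ) * (ρ - r + d) * (r + ρ - d) * (r + d + ρ)) / (2 * ρ)) := by
  obtain ⟨hr1, hr2⟩ := hr
  obtain ⟨hρ1, hρ2⟩ := hρ
  have hd : 0 < d := by linarith
  have hR₀ : 0 < R₀ := by linarith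
  have hρ0 : 0 < ρ := by linarith
  have hS : 0 < r + d + ρ := by linarith
  set A := r + d - ρ with hAd
  set B := ρ - r + d with hBd
  set C := r + ρ - d with hCd
  have key : √d * (r₀ / √(2 * R₀)) ≤ √B * √C + √A * √C + √A * √B := by
    refine le_trans ?_ (Real.sqrt_le_iff.2 ⟨by positivity, ?_⟩ :
      √(B * C + A * C + A * B) ≤ _)
    · refine Real.le_sqrt_of_sq_le ?_
      rw [mul_pow, div_pow, Real.sq_sqrt hd.le, Real.sq_sqrt (by positivity), ← mul_div_assoc,
        div_le_iff₀ (by positivity)]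
      rcases le_or_gt r₀ C with h | h
      · have h1 : 2 * d * r₀ ≤ B * C + A * C := by
          have : 2 * d = A + B := by rw [hAd, hBd]; ring
          rw [this]
          nlinarith
        have h2 : 0 < A * B := mul_pos hA hB
        have h3 : d * r₀ ^ 2 ≤ 2 * d * r₀ * (2 * R₀) := by
          have : 0 < d * r₀ := mul_pos hd hr₀
          nlinarith
        nlinarith
      · have hA' : r₀ ≤ A := by linarith
        have hB' : r₀ ≤ B := by linarith
        have h1 : r₀ ^ 2 ≤ A * B := by nlinarith
        have h2 : 0 < B * C := mul_pos hB hC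
        have h3 : 0 < A * C := mul_pos hA hC
        have h4 : d ≤ 2 * R₀ := by linarith
        have h5 : d * r₀ ^ 2 ≤ (2 * R₀) * (A * B) := by gcongr
        nlinarith
    · have a1 := Real.sq_sqrt hA.le
      have b1 := Real.sq_sqrt hB.le
      have c1 := Real.sq_sqrt hC.le
      have a0 := Real.sqrt_nonneg A
      have b0 := Real.sqrt_nonneg B
      have c0 := Real.sqrt_nonneg C
      calc B * C + A * C + A * B = √B ^ 2 * √C ^ 2 + √A ^ 2 * √C ^ 2 + √A ^ 2 * √B ^ 2 := by
            rw [a1, b1, c1]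
        _ ≤ _ := by
            have : 0 ≤ 2 * (√B * √C * (√A * √C) + √B * √C * (√A * √B) + √A * √C * (√A * √B)) := by
              positivity
            linarith
  have hS' : √r₀ ≤ √(r + d + ρ) := Real.sqrt_le_sqrt (by linarith)
  have sA := Real.sqrt_pos.2 hA
  have sB := Real.sqrt_pos.2 hB
  have sC := Real.sqrt_pos.2 hC
  have sd := Real.sqrt_pos.2 hd
  have sr := Real.sqrt_pos.2 hr₀
  have sR : 0 < √(2 * R₀) := Real.sqrt_pos.2 (by positivity)
  have e : bipolarConst r₀ R₀ * (√d)⁻¹ * ((√A)⁻¹ + (√B)⁻¹ + (√C)⁻¹) *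
      (√(A * B * C * (r + d + ρ)) / (2 * ρ)) =
      bipolarConst r₀ R₀ * (√d)⁻¹ * (√B * √C + √A * √C + √A * √B) *
        √(r + d + ρ) / (2 * ρ) := by
    rw [Real.sqrt_mul (by positivity), Real.sqrt_mul (by positivity), Real.sqrt_mul hA.le]
    field_simp
  rw [e]
  have hK : 0 ≤ bipolarConst r₀ R₀ := by unfold bipolarConst; positivity
  calc (1 : ℝ) ≤ R₀ / ρ := by rwa [le_div_iff₀ hρ0, one_mul]
    _ = bipolarConst r₀ R₀ * (√d)⁻¹ * (√d * (r₀ / √(2 * R₀))) * √r₀ / (2 * ρ) := by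
        unfold bipolarConst
        field_simp
    _ ≤ bipolarConst r₀ R₀ * (√d)⁻¹ * (√B * √C + √A * √C + √A * √B) *
        √(r + d + ρ) / (2 * ρ) := by gcongr

/-- The distance from the point at polar angle `θ` and radius `r` to a point at distance `d`
from the origin. -/
noncomputable def chord (r d θ : ℝ) : ℝ := √(r ^ 2 + d ^ 2 + 2 * r * d * Real.cos θ)

theorem continuous_chord (r d : ℝ) : Continuous (chord r d) := by
  unfold chord
  fun_prop

theorem setLIntegral_chord_le {r₀ R₀ r d : ℝ} (hr₀ : 0 < r₀) (hr : r ∈ Set.Ioc r₀ R₀)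
    (hd : 0 < d) {h : ℝ → ℝ≥0∞} (hh : Measurable h) :
    ∫⁻ θ in Set.Ioo 0 Real.pi, (Set.Ioc r₀ R₀).indicator h (chord r d θ) ≤
      ENNReal.ofReal (bipolarConst r₀ R₀ * (√d)⁻¹) *
        ∫⁻ ρ, (Set.Ioc r₀ R₀).indicator h ρ * annulusKernel d r ρ := by
  have hr0 : 0 < r := hr₀.trans hr.1
  have hR₀ : 0 < R₀ := hr0.trans_le hr.2
  have hrd : 0 < r * d := mul_pos hr0 hd
  have hcos {θ : ℝ} (hθ : θ ∈ Set.Ioo 0 Real.pi) : -1 < Real.cos θ ∧ Real.cos θ < 1 := by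
    have hs := Real.sin_pos_of_mem_Ioo hθ
    constructor <;> nlinarith [Real.sin_sq_add_cos_sq θ]
  have hpos {θ : ℝ} (hθ : θ ∈ Set.Ioo 0 Real.pi) :
      0 < r ^ 2 + d ^ 2 + 2 * r * d * Real.cos θ := by
    nlinarith [hcos hθ, sq_nonneg (r - d)]
  have hchord {θ : ℝ} (hθ : θ ∈ Set.Ioo 0 Real.pi) : 0 < chord r d θ := Real.sqrt_pos.2 (hpos hθ)
  have hderiv : ∀ θ ∈ Set.Ioo 0 Real.pi, HasDerivWithinAt (chord r d)
      (-(r * d * Real.sin θ) / chord r d θ) (Set.Ioo 0 Real.pi) θ := by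
    intro θ hθ
    have h1 : HasDerivAt (fun θ => r ^ 2 + d ^ 2 + 2 * r * d * Real.cos θ)
        (2 * r * d * -Real.sin θ) θ :=
      ((Real.hasDerivAt_cos θ).const_mul (2 * r * d)).const_add _
    refine ((h1.sqrt (hpos hθ).ne').congr_deriv ?_).hasDerivWithinAt
    have := hchord hθ
    unfold chord at this ⊢
    field_simp
  have hinj : Set.InjOn (chord r d) (Set.Ioo 0 Real.pi) := by
    intro θ hθ θ' hθ' h
    have h2 := (Real.sqrt_inj (hpos hθ).le (hpos hθ').le).1 h
    refine Real.injOn_cos (Set.Ioo_subset_Icc_self hθ) (Set.Ioo_subset_Icc_self hθ') ?_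
    have h3 : (2 * r * d) * Real.cos θ = (2 * r * d) * Real.cos θ' := by linarith
    exact mul_left_cancel₀ (by positivity) h3
  have hcv := lintegral_image_eq_lintegral_abs_deriv_mul measurableSet_Ioo hderiv hinj
    (fun ρ => (Set.Ioc r₀ R₀).indicator h ρ * annulusKernel d r ρ)
  have hm : Measurable fun ρ => (Set.Ioc r₀ R₀).indicator h ρ * annulusKernel d r ρ :=
    (hh.indicator measurableSet_Ioc).mul (measurable_annulusKernel d r)
  refine le_trans ?_ (mul_le_mul_right (setLIntegral_le_lintegral
    (chord r d '' Set.Ioo 0 Real.pi) _) _)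
  rw [hcv, ← lintegral_const_mul' _ _ ENNReal.ofReal_ne_top]
  refine setLIntegral_mono' measurableSet_Ioo fun θ hθ => ?_
  by_cases hJ : chord r d θ ∈ Set.Ioc r₀ R₀
  swap
  · simp [Set.indicator_of_notMem hJ]
  set ρ := chord r d θ with hρ
  have hρ0 : 0 < ρ := hchord hθ
  have hρsq : ρ ^ 2 = r ^ 2 + d ^ 2 + 2 * r * d * Real.cos θ := Real.sq_sqrt (hpos hθ).le
  obtain ⟨hc1, hc2⟩ := hcos hθ
  have hA : 0 < r + d - ρ := by
    have : ρ ^ 2 < (r + d) ^ 2 := by nlinarith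
    linarith [lt_of_pow_lt_pow_left₀ 2 (by positivity) this]
  have hBC : (r - d) ^ 2 < ρ ^ 2 := by nlinarith
  have habs := abs_lt_of_sq_lt_sq' hBC hρ0.le
  have hB : 0 < ρ - r + d := by linarith [habs.2]
  have hC : 0 < r + ρ - d := by linarith [habs.1]
  have hs : r * d * Real.sin θ =
      √((r + d - ρ) * (ρ - r + d) * (r + ρ - d) * (r + d + ρ)) / 2 := by
    have hsin := Real.sin_pos_of_mem_Ioo hθ
    rw [_root_.eq_div_iff two_ne_zero, eq_comm, Real.sqrt_eq_iff_mul_self_eq (by positivity)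
      (by positivity)]
    have : (r + d - ρ) * (ρ - r + d) * (r + ρ - d) * (r + d + ρ) =
      ((r + d) ^ 2 - ρ ^ 2) * (ρ ^ 2 - (r - d) ^ 2) := by ring
    rw [this, hρsq]
    have h4 : Real.sin θ ^ 2 = 1 - Real.cos θ ^ 2 := Real.sin_sq θ
    linear_combination (-4 * (r * d) ^ 2) * h4
  have hker : annulusKernel d r ρ = ENNReal.ofReal
      ((√(r + d - ρ))⁻¹ + (√(ρ - r + d))⁻¹ + (√(r + ρ - d))⁻¹) := by
    rw [annulusKernel, invSqrt_eq, invSqrt_eq, invSqrt_eq,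
      ENNReal.ofReal_add (by positivity) (by positivity),
      ENNReal.ofReal_add (by positivity) (by positivity), abs_of_pos hC,
      show r - ρ + d = r + d - ρ by ring, abs_of_pos hA,
      show r - ρ - d = -(ρ - r + d) by ring, abs_neg, abs_of_pos hB]
    ring
  have h1 := one_le_bipolar hr₀ hr hJ hA hB hC
  have hd' : |-(r * d * Real.sin θ) / ρ| =
      √((r + d - ρ) * (ρ - r + d) * (r + ρ - d) * (r + d + ρ)) / (2 * ρ) := by
    have hsin := Real.sin_pos_of_mem_Ioo hθ
    rw [abs_div, abs_neg, abs_of_pos (by positivity), abs_of_pos hρ0, hs, div_div]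
  have hK : 0 ≤ bipolarConst r₀ R₀ := by unfold bipolarConst; positivity
  rw [hker, hd']
  calc (Set.Ioc r₀ R₀).indicator h ρ = 1 * (Set.Ioc r₀ R₀).indicator h ρ := (one_mul _).symm
    _ ≤ _ := by
      refine (mul_le_mul_left (ENNReal.one_le_ofReal.2 h1) _).trans (le_of_eq ?_)
      rw [ENNReal.ofReal_mul (by positivity), ENNReal.ofReal_mul (by positivity)]
      ring

theorem norm_smul_circlePt_add (r d θ : ℝ) :
    ‖d • circlePt 0 + r • circlePt θ‖ = chord r d θ := by
  rw [EuclideanSpace.norm_eq, chord]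
  congr 1
  simp [circlePt, Fin.sum_univ_two]
  linear_combination r ^ 2 * Real.sin_sq_add_cos_sq θ

theorem lintegral_comp_dist_mul_comp_dist {H₁ H₂ : ℝ → ℝ≥0∞} (hH₁ : Measurable H₁)
    (hH₂ : Measurable H₂) (x x' : Plane) :
    ∫⁻ y, H₁ ‖x - y‖ * H₂ ‖x' - y‖ = ∫⁻ r in Set.Ioi (0 : ℝ),
      ENNReal.ofReal r * (H₁ r * (2 * ∫⁻ θ in Set.Ioo 0 Real.pi, H₂ (chord r ‖x' - x‖ θ))) := by
  set d := ‖x' - x‖ with hd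
  obtain ⟨A, hA⟩ : ∃ A : Plane ≃ₗᵢ[ℝ] Plane, A (d • circlePt 0) = x' - x :=
    ⟨_, Submodule.reflection_sub (v := d • circlePt 0) (w := x' - x) (by
      rw [norm_smul, norm_circlePt, mul_one, Real.norm_of_nonneg (norm_nonneg _)])⟩
  have hmeas : Measurable fun z : Plane => H₁ ‖z‖ * H₂ ‖d • circlePt 0 + z‖ :=
    (hH₁.comp (by fun_prop)).mul (hH₂.comp (by fun_prop))
  have hm' : Measurable fun z : Plane => H₁ ‖z‖ * H₂ ‖x' - x + z‖ :=
    (hH₁.comp (by fun_prop)).mul (hH₂.comp (by fun_prop))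
  calc
    _ = ∫⁻ z, H₁ ‖z‖ * H₂ ‖x' - x + z‖ := by
        rw [← lintegral_sub_left_eq_self _ x]
        refine lintegral_congr fun z => ?_
        rw [sub_sub_cancel x z, sub_add x' x z]
    _ = ∫⁻ z, H₁ ‖z‖ * H₂ ‖d • circlePt 0 + z‖ := by
        rw [← A.measurePreserving.lintegral_comp hm']
        refine lintegral_congr fun z => ?_
        rw [← hA, ← map_add, A.norm_map, A.norm_map]
    _ = _ := by
        rw [lintegral_plane_eq_polar hmeas]
        refine setLIntegral_congr_fun measurableSet_Ioi fun r hr => ?_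
        have hr' : 0 < r := hr
        have hnr (θ : ℝ) : ‖r • circlePt θ‖ = r := by
          rw [norm_smul, norm_circlePt, mul_one, Real.norm_of_nonneg hr'.le]
        simp only [norm_smul_circlePt_add, hnr]
        have hc : Measurable fun θ => H₂ (chord r d θ) := hH₂.comp (continuous_chord r d).measurable
        rw [lintegral_const_mul _ (hc.const_mul _), lintegral_const_mul _ hc]
        congr 2
        have hset : Set.Ioo (-Real.pi) Real.pi = {θ : ℝ | |θ| < Real.pi} := by
          ext θ
          simp [abs_lt]
        rw [← lintegral_indicator measurableSet_Ioo]
        have hG : Measurable ((Set.Iio Real.pi).indicator fun θ => H₂ (chord r d θ)) :=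
          hc.indicator measurableSet_Iio
        have := lintegral_comp_abs_eq hG
        rw [setLIntegral_indicator measurableSet_Iio, Set.inter_comm, Set.Ioi_inter_Iio] at this
        rw [← this]
        refine lintegral_congr fun θ => ?_
        simp only [Set.indicator_apply, hset, Set.mem_ofPred_eq, Set.mem_Iio, chord, Real.cos_abs]

/-- Two radial functions supported on annuli: the bilinear estimate. -/
theorem exists_lintegral_annuli_le {r₀ : ℝ} (R₀ : ℝ) (hr₀ : 0 < r₀) :
    ∃ C : ℝ≥0∞, C ≠ ⊤ ∧ ∀ x x' : Plane, x' ≠ x → ∀ h₁ h₂ : ℝ → ℝ≥0∞,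
      Measurable h₁ → Measurable h₂ →
      ∫⁻ y, (Set.Ioc r₀ R₀).indicator h₁ ‖x - y‖ * (Set.Ioc r₀ R₀).indicator h₂ ‖x' - y‖ ≤
        C * edist x' x ^ (-(1 / 2) : ℝ) *
          ((∫⁻ r in Set.Ioc r₀ R₀, h₁ r ^ (4 / 3 : ℝ)) ^ (3 / 4 : ℝ) *
          (∫⁻ r in Set.Ioc r₀ R₀, h₂ r ^ (4 / 3 : ℝ)) ^ (3 / 4 : ℝ)) := by
  refine ⟨72 * ENNReal.ofReal R₀ * ENNReal.ofReal (bipolarConst r₀ R₀), by finiteness, ?_⟩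
  intro x x' hxx h₁ h₂ hh₁ hh₂
  have hH₁ := hh₁.indicator (measurableSet_Ioc (a := r₀) (b := R₀))
  have hH₂ := hh₂.indicator (measurableSet_Ioc (a := r₀) (b := R₀))
  have hd : 0 < ‖x' - x‖ := norm_pos_iff.2 (sub_ne_zero.2 hxx)
  have hed : edist x' x ^ (-(1 / 2) : ℝ) = ENNReal.ofReal (√‖x' - x‖)⁻¹ := by
    rw [edist_dist, dist_eq_norm, ENNReal.ofReal_rpow_of_pos hd, Real.rpow_neg hd.le,
      Real.sqrt_eq_rpow]
  have hpow (h : ℝ → ℝ≥0∞) : ∫⁻ r, (Set.Ioc r₀ R₀).indicator h r ^ (4 / 3 : ℝ) =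
      ∫⁻ r in Set.Ioc r₀ R₀, h r ^ (4 / 3 : ℝ) := by
    rw [← lintegral_indicator measurableSet_Ioc]
    refine lintegral_congr fun r => ?_
    by_cases hr : r ∈ Set.Ioc r₀ R₀ <;> simp [hr]
  rw [lintegral_comp_dist_mul_comp_dist hH₁ hH₂, hed]
  set d := ‖x' - x‖
  set H₁ := (Set.Ioc r₀ R₀).indicator h₁
  set H₂ := (Set.Ioc r₀ R₀).indicator h₂
  set K := ENNReal.ofReal (bipolarConst r₀ R₀ * (√d)⁻¹)
  have hKe : K = ENNReal.ofReal (bipolarConst r₀ R₀) * ENNReal.ofReal (√d)⁻¹ :=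
    ENNReal.ofReal_mul' (by positivity)
  have hKt : K ≠ ⊤ := ENNReal.ofReal_ne_top
  calc
    _ ≤ ∫⁻ r, (2 * ENNReal.ofReal R₀ * K) * ∫⁻ ρ, H₁ r * H₂ ρ * annulusKernel d r ρ := by
        refine (setLIntegral_le_lintegral _ _).trans (lintegral_mono fun r => ?_)
        by_cases hr : r ∈ Set.Ioc r₀ R₀
        swap
        · simp [H₁, hr]
        simp only [mul_assoc (H₁ r)]
        rw [lintegral_const_mul _ (f := fun ρ => H₂ ρ * annulusKernel d r ρ)
          (hH₂.mul (measurable_annulusKernel d r))]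
        have := setLIntegral_chord_le hr₀ hr hd hh₂
        calc _ ≤ ENNReal.ofReal R₀ * (H₁ r * (2 * (K *
              ∫⁻ ρ, H₂ ρ * annulusKernel d r ρ))) := by
              gcongr
              exact hr.2
          _ = _ := by ring
    _ = (2 * ENNReal.ofReal R₀ * K) * ∫⁻ r, ∫⁻ ρ, H₁ r * H₂ ρ * annulusKernel d r ρ :=
        lintegral_const_mul' _ _ (by finiteness)
    _ ≤ (2 * ENNReal.ofReal R₀ * K) * (36 * ((∫⁻ r, H₁ r ^ (4 / 3 : ℝ)) ^ (3 / 4 : ℝ) *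
        (∫⁻ r, H₂ r ^ (4 / 3 : ℝ)) ^ (3 / 4 : ℝ))) := by
        gcongr
        exact lintegral_mul_annulusKernel_le hH₁ hH₂ d
    _ = _ := by
        rw [hpow, hpow, hKe]
        ring

theorem measure_singleton_eq_zero_of_ball_le {X : Type*} [PseudoMetricSpace X]
    [MeasurableSpace X] {μ : Measure X} {a C : ℝ} (ha : 0 < a)
    (h : ∀ (x : X) (δ : ℝ), 0 < δ → μ (ball x δ) ≤ ENNReal.ofReal (C * δ ^ a)) (x : X) :
    μ {x} = 0 := by
  have ht : Filter.Tendsto (fun δ : ℝ => ENNReal.ofReal (C * δ ^ a))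
      (nhdsWithin 0 (Set.Ioi 0)) (nhds 0) := by
    have h1 : Filter.Tendsto (fun δ : ℝ => ENNReal.ofReal (C * δ ^ a)) (nhds 0)
        (nhds (ENNReal.ofReal (C * 0 ^ a))) :=
      (ENNReal.continuous_ofReal.tendsto _).comp
        ((Real.continuousAt_rpow_const 0 a (Or.inr ha.le)).tendsto.const_mul C)
    rw [Real.zero_rpow ha.ne', mul_zero, ENNReal.ofReal_zero] at h1
    exact h1.mono_left nhdsWithin_le_nhds
  refine le_antisymm (ge_of_tendsto ht ?_) zero_le
  filter_upwards [self_mem_nhdsWithin] with δ hδ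
  exact (measure_mono (Set.singleton_subset_iff.2 (mem_ball_self hδ))).trans (h x δ hδ)

/-- Riesz potentials of a measure satisfying a Frostman condition are uniformly bounded. -/
theorem exists_lintegral_edist_rpow_neg_le {X : Type*} [MetricSpace X]
    [MeasurableSpace X] [OpensMeasurableSpace X] {μ : Measure X} [IsProbabilityMeasure μ]
    {a b C : ℝ} (ha : 0 < a) (hab : a < b)
    (h : ∀ (x : X) (δ : ℝ), 0 < δ → μ (ball x δ) ≤ ENNReal.ofReal (C * δ ^ b)) :
    ∃ K : ℝ≥0∞, K ≠ ⊤ ∧ ∀ x, ∫⁻ x', edist x' x ^ (-a) ∂μ ≤ K := by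
  have hb : 0 < b := ha.trans hab
  have hba : -(b / a) < -1 := by
    rw [neg_lt_neg_iff, one_lt_div ha]
    exact hab
  have hint : IntegrableOn (fun t : ℝ => C * t ^ (-(b / a))) (Set.Ioi 1) :=
    (integrableOn_Ioi_rpow_of_lt hba one_pos).const_mul C
  refine ⟨1 + ∫⁻ t in Set.Ioi (1 : ℝ), ENNReal.ofReal (C * t ^ (-(b / a))),
    ENNReal.add_ne_top.2 ⟨one_ne_top, hint.lintegral_lt_top.ne⟩, fun x => ?_⟩
  have hne : ∀ᵐ x' ∂μ, x' ≠ x := by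
    rw [ae_iff]
    simpa using measure_singleton_eq_zero_of_ball_le hb h x
  have hmeas : Measurable fun x' => dist x' x ^ (-a) :=
    (continuous_id.dist continuous_const).measurable.pow_const _
  calc
    _ = ∫⁻ x', ENNReal.ofReal (dist x' x ^ (-a)) ∂μ := by
        refine lintegral_congr_ae ?_
        filter_upwards [hne] with x' hx'
        rw [edist_dist, ENNReal.ofReal_rpow_of_pos (dist_pos.2 hx')]
    _ = ∫⁻ t in Set.Ioi 0, μ {x' | t < dist x' x ^ (-a)} :=
        lintegral_eq_lintegral_meas_lt μ
          (Filter.Eventually.of_forall fun x' => Real.rpow_nonneg dist_nonneg _) hmeas.aemeasurable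
    _ = (∫⁻ t in Set.Ioc 0 1, μ {x' | t < dist x' x ^ (-a)}) +
        ∫⁻ t in Set.Ioi 1, μ {x' | t < dist x' x ^ (-a)} := by
        rw [← lintegral_union measurableSet_Ioi (Set.Ioc_disjoint_Ioi le_rfl),
          Set.Ioc_union_Ioi_eq_Ioi zero_le_one]
    _ ≤ _ := by
        refine add_le_add ?_ (setLIntegral_mono' measurableSet_Ioi fun t ht => ?_)
        · calc
            _ ≤ ∫⁻ t in Set.Ioc (0 : ℝ) 1, 1 := lintegral_mono fun t => prob_le_one
            _ = 1 := by simp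
        · have ht0 : 0 < t := one_pos.trans ht
          have hsub : {x' | t < dist x' x ^ (-a)} ⊆ ball x (t ^ (-a⁻¹)) := by
            intro x' (hx' : t < dist x' x ^ (-a))
            rw [mem_ball]
            rcases dist_nonneg.eq_or_lt (a := 0) (b := dist x' x) with h0 | h0
            · rw [← h0]
              exact Real.rpow_pos_of_pos ht0 _
            · have := Real.rpow_lt_rpow_of_neg ht0 hx' (neg_lt_zero.2 (inv_pos.2 ha))
              rwa [← Real.rpow_mul h0.le, neg_mul_neg, mul_inv_cancel₀ ha.ne',
                Real.rpow_one] at this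
          refine (measure_mono hsub).trans ((h x _ (Real.rpow_pos_of_pos ht0 _)).trans_eq ?_)
          rw [← Real.rpow_mul ht0.le, neg_mul, inv_mul_eq_div]

theorem lintegral_lintegral_mul_sqrt_le {X : Type*} [MeasurableSpace X] {μ : Measure X}
    [SFinite μ] {k : X → X → ℝ≥0∞} (hk : Measurable (Function.uncurry k)) {K : ℝ≥0∞}
    (h₁ : ∀ x, ∫⁻ x', k x x' ∂μ ≤ K) (h₂ : ∀ x', ∫⁻ x, k x x' ∂μ ≤ K)
    {W : X → ℝ≥0∞} (hW : Measurable W) :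
    ∫⁻ z, k z.1 z.2 * (W z.1 ^ (1 / 2 : ℝ) * W z.2 ^ (1 / 2 : ℝ)) ∂μ.prod μ ≤
      K * ∫⁻ x, W x ∂μ := by
  have hk' : Measurable fun z : X × X => k z.1 z.2 := hk
  have m₁ : Measurable fun z : X × X => k z.1 z.2 * W z.1 := hk'.mul (hW.comp measurable_fst)
  have m₂ : Measurable fun z : X × X => k z.1 z.2 * W z.2 := hk'.mul (hW.comp measurable_snd)
  have e₁ : ∫⁻ z, k z.1 z.2 * W z.1 ∂μ.prod μ ≤ K * ∫⁻ x, W x ∂μ := by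
    rw [lintegral_prod _ m₁.aemeasurable, ← lintegral_const_mul _ hW]
    refine lintegral_mono fun x => ?_
    dsimp only
    rw [lintegral_mul_const _ (f := fun x' => k x x') (hk'.comp measurable_prodMk_left)]
    exact mul_le_mul_left (h₁ x) _
  have e₂ : ∫⁻ z, k z.1 z.2 * W z.2 ∂μ.prod μ ≤ K * ∫⁻ x, W x ∂μ := by
    rw [lintegral_prod_symm _ m₂.aemeasurable, ← lintegral_const_mul _ hW]
    refine lintegral_mono fun x' => ?_
    dsimp only
    rw [lintegral_mul_const _ (f := fun x => k x x') (hk'.comp measurable_prodMk_right)]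
    exact mul_le_mul_left (h₂ x') _
  calc
    _ = ∫⁻ z, (k z.1 z.2 * W z.1) ^ (1 / 2 : ℝ) * (k z.1 z.2 * W z.2) ^ (1 / 2 : ℝ)
          ∂μ.prod μ := by
        refine lintegral_congr fun z => ?_
        rw [ENNReal.mul_rpow_of_nonneg _ _ (by norm_num), ENNReal.mul_rpow_of_nonneg _ _
          (by norm_num), mul_mul_mul_comm, ← ENNReal.rpow_add_of_nonneg _ _ (by norm_num)
          (by norm_num), add_halves, ENNReal.rpow_one]
    _ ≤ _ := ENNReal.lintegral_mul_norm_pow_le m₁.aemeasurable m₂.aemeasurable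
        (by norm_num) (by norm_num) (add_halves 1)
    _ ≤ (K * ∫⁻ x, W x ∂μ) ^ (1 / 2 : ℝ) * (K * ∫⁻ x, W x ∂μ) ^ (1 / 2 : ℝ) := by gcongr
    _ = _ := by
        rw [← ENNReal.rpow_add_of_nonneg _ _ (by norm_num) (by norm_num), add_halves,
          ENNReal.rpow_one]

/-- Fractional powers of a kernel with bounded marginals act on products of powers. -/
theorem lintegral_lintegral_rpow_mul_le {X : Type*} [MeasurableSpace X] {μ : Measure X}
    [SFinite μ] {k : X → X → ℝ≥0∞} (hk : Measurable (Function.uncurry k)) {K : ℝ≥0∞}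
    (h₁ : ∀ x, ∫⁻ x', k x x' ∂μ ≤ K) (h₂ : ∀ x', ∫⁻ x, k x x' ∂μ ≤ K)
    {W : X → ℝ≥0∞} (hW : Measurable W) {θ : ℝ} (hθ : 0 < θ) (hθ' : θ ≤ 1) :
    ∫⁻ x, ∫⁻ x', k x x' ^ θ * (W x ^ (1 - θ / 2) * W x' ^ (1 - θ / 2)) ∂μ ∂μ ≤
      K ^ θ * (∫⁻ x, W x ∂μ) ^ (2 - θ) := by
  have hk' : Measurable fun z : X × X => k z.1 z.2 := hk
  have hW₁ : Measurable fun z : X × X => W z.1 := hW.comp measurable_fst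
  have hW₂ : Measurable fun z : X × X => W z.2 := hW.comp measurable_snd
  have hsplit (w : ℝ≥0∞) : w ^ (1 - θ / 2) = w ^ (1 - θ) * (w ^ (1 / 2 : ℝ)) ^ θ := by
    rw [← ENNReal.rpow_mul, ← ENNReal.rpow_add_of_nonneg _ _ (by linarith) (by positivity)]
    congr 1
    ring
  calc
    _ = ∫⁻ z, k z.1 z.2 ^ θ * (W z.1 ^ (1 - θ / 2) * W z.2 ^ (1 - θ / 2)) ∂μ.prod μ := by
        rw [lintegral_prod]
        exact ((hk'.pow_const _).mul
          ((hW₁.pow_const _).mul (hW₂.pow_const _))).aemeasurable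
    _ = ∫⁻ z, (W z.1 * W z.2) ^ (1 - θ) *
          (k z.1 z.2 * (W z.1 ^ (1 / 2 : ℝ) * W z.2 ^ (1 / 2 : ℝ))) ^ θ ∂μ.prod μ := by
        refine lintegral_congr fun z => ?_
        rw [hsplit, hsplit, ENNReal.mul_rpow_of_nonneg _ _ (by linarith),
          ENNReal.mul_rpow_of_nonneg _ _ hθ.le, ENNReal.mul_rpow_of_nonneg _ _ hθ.le]
        ring
    _ ≤ (∫⁻ z, W z.1 * W z.2 ∂μ.prod μ) ^ (1 - θ) *
          (∫⁻ z, k z.1 z.2 * (W z.1 ^ (1 / 2 : ℝ) * W z.2 ^ (1 / 2 : ℝ)) ∂μ.prod μ) ^ θ :=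
        ENNReal.lintegral_mul_norm_pow_le (hW₁.mul hW₂).aemeasurable
          (hk'.mul ((hW₁.pow_const _).mul (hW₂.pow_const _))).aemeasurable
          (by linarith) hθ.le (by ring)
    _ ≤ ((∫⁻ x, W x ∂μ) * ∫⁻ x, W x ∂μ) ^ (1 - θ) * (K * ∫⁻ x, W x ∂μ) ^ θ := by
        rw [lintegral_prod_mul hW.aemeasurable hW.aemeasurable]
        gcongr
        exact lintegral_lintegral_mul_sqrt_le hk h₁ h₂ hW
    _ = _ := by
        rw [ENNReal.mul_rpow_of_nonneg _ _ (by linarith), ENNReal.mul_rpow_of_nonneg _ _ hθ.le,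
          ← ENNReal.rpow_add_of_nonneg _ _ (by linarith) (by linarith), mul_left_comm,
          ← ENNReal.rpow_add_of_nonneg _ _ (by linarith) hθ.le]
        congr 2
        ring

/-- The `s`-th power of the radial `L^s` norm of the circular averages centred at `x`. -/
noncomputable def circEnergy (r₀ R₀ s : ℝ) (f : Plane → ℝ≥0∞) (x : Plane) : ℝ≥0∞ :=
  ∫⁻ r in Set.Ioc r₀ R₀, circAvg f x r ^ s

/-- The radial weight on an annulus centred at `x` which is dual to the circular averages. -/
noncomputable def annulusWeight (r₀ R₀ s : ℝ) (f : Plane → ℝ≥0∞) (x y : Plane) : ℝ≥0∞ :=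
  (Set.Ioc r₀ R₀).indicator (fun r => circAvg f x r ^ (s - 1)) ‖x - y‖

theorem measurable_circEnergy (r₀ R₀ s : ℝ) {f : Plane → ℝ≥0∞} (hf : Measurable f) :
    Measurable (circEnergy r₀ R₀ s f) :=
  ((measurable_circAvg hf).pow_const s).lintegral_prod_right'

theorem measurable_circAvg_right {f : Plane → ℝ≥0∞} (hf : Measurable f) (x : Plane) :
    Measurable (circAvg f x) :=
  (measurable_circAvg hf).comp measurable_prodMk_left

theorem measurable_annulusWeight (r₀ R₀ s : ℝ) {f : Plane → ℝ≥0∞} (hf : Measurable f) :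
    Measurable fun z : Plane × Plane => annulusWeight r₀ R₀ s f z.1 z.2 := by
  have hn : Measurable fun z : Plane × Plane => ‖z.1 - z.2‖ :=
    (continuous_fst.sub continuous_snd).norm.measurable
  have hu : Measurable fun z : Plane × Plane => circAvg f z.1 ‖z.1 - z.2‖ ^ (s - 1) :=
    ((measurable_circAvg hf).comp (measurable_fst.prodMk hn)).pow_const _
  exact hu.indicator (hn measurableSet_Ioc)

theorem measurable_annulusWeight_right (r₀ R₀ s : ℝ) {f : Plane → ℝ≥0∞} (hf : Measurable f)
    (x : Plane) : Measurable (annulusWeight r₀ R₀ s f x) := by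
  have h : Measurable fun y : Plane => ‖x - y‖ :=
    (continuous_const.sub continuous_id).norm.measurable
  have hu := ((measurable_circAvg_right hf x).pow_const (s - 1)).indicator
    (measurableSet_Ioc (a := r₀) (b := R₀))
  exact hu.comp h

theorem lintegral_annulusWeight_mul {r₀ R₀ s : ℝ} (hr₀ : 0 ≤ r₀) (hs : 1 ≤ s)
    {f : Plane → ℝ≥0∞} (hf : Measurable f) (x : Plane) :
    ∫⁻ y, annulusWeight r₀ R₀ s f x y * f y =
      ∫⁻ r in Set.Ioc r₀ R₀, ENNReal.ofReal r * circAvg f x r ^ s := by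
  have hu := measurable_circAvg_right hf x
  unfold annulusWeight
  rw [lintegral_radial_mul ((hu.pow_const _).indicator measurableSet_Ioc) hf,
    ← lintegral_indicator measurableSet_Ioi, ← lintegral_indicator measurableSet_Ioc]
  refine lintegral_congr fun r => ?_
  by_cases hr : r ∈ Set.Ioc r₀ R₀
  · have hr' : r ∈ Set.Ioi (0 : ℝ) := hr₀.trans_lt hr.1
    rw [Set.indicator_of_mem hr', Set.indicator_of_mem hr, Set.indicator_of_mem hr]
    congr 1
    nth_rewrite 2 [← ENNReal.rpow_one (circAvg f x r)]
    rw [← ENNReal.rpow_add_of_nonneg _ _ (by linarith) zero_le_one, sub_add_cancel]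
  · rw [Set.indicator_of_notMem hr]
    refine Set.indicator_apply_eq_zero.2 fun _ => ?_
    rw [Set.indicator_of_notMem hr, zero_mul, mul_zero]

theorem lintegral_annulusWeight_mul_le {r₀ R₀ s : ℝ} (hr₀ : 0 ≤ r₀) (hs : 1 ≤ s)
    {f : Plane → ℝ≥0∞} (hf : Measurable f) (x : Plane) :
    ∫⁻ y, annulusWeight r₀ R₀ s f x y * f y ≤ ENNReal.ofReal R₀ * circEnergy r₀ R₀ s f x := by
  rw [lintegral_annulusWeight_mul hr₀ hs hf, circEnergy,
    ← lintegral_const_mul _ ((measurable_circAvg_right hf x).pow_const s)]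
  exact setLIntegral_mono' measurableSet_Ioc fun r hr =>
    mul_le_mul_left (ENNReal.ofReal_le_ofReal hr.2) _

theorem mul_circEnergy_le {r₀ R₀ s : ℝ} (hr₀ : 0 ≤ r₀) (hs : 1 ≤ s)
    {f : Plane → ℝ≥0∞} (hf : Measurable f) (x : Plane) :
    ENNReal.ofReal r₀ * circEnergy r₀ R₀ s f x ≤ ∫⁻ y, annulusWeight r₀ R₀ s f x y * f y := by
  rw [lintegral_annulusWeight_mul hr₀ hs hf, circEnergy,
    ← lintegral_const_mul _ ((measurable_circAvg_right hf x).pow_const s)]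
  exact setLIntegral_mono' measurableSet_Ioc fun r hr =>
    mul_le_mul_left (ENNReal.ofReal_le_ofReal hr.1.le) _

theorem lintegral_mul_sqrt_annulusWeight_le {r₀ R₀ s : ℝ} (hr₀ : 0 ≤ r₀) (hs : 1 ≤ s)
    {f : Plane → ℝ≥0∞} (hf : Measurable f) (x x' : Plane) :
    ∫⁻ y, f y * (annulusWeight r₀ R₀ s f x y ^ (1 / 2 : ℝ) *
        annulusWeight r₀ R₀ s f x' y ^ (1 / 2 : ℝ)) ≤
      ENNReal.ofReal R₀ *
        (circEnergy r₀ R₀ s f x * circEnergy r₀ R₀ s f x') ^ (1 / 2 : ℝ) := by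
  have hg := measurable_annulusWeight_right r₀ R₀ s hf
  calc
    _ = ∫⁻ y, (annulusWeight r₀ R₀ s f x y * f y) ^ (1 / 2 : ℝ) *
          (annulusWeight r₀ R₀ s f x' y * f y) ^ (1 / 2 : ℝ) := by
        refine lintegral_congr fun y => ?_
        rw [ENNReal.mul_rpow_of_nonneg _ _ (by norm_num), ENNReal.mul_rpow_of_nonneg _ _
          (by norm_num), mul_mul_mul_comm, ← ENNReal.rpow_add_of_nonneg (x := f y) _ _
          (by norm_num) (by norm_num), add_halves, ENNReal.rpow_one, mul_comm]
    _ ≤ (∫⁻ y, annulusWeight r₀ R₀ s f x y * f y) ^ (1 / 2 : ℝ) *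
          (∫⁻ y, annulusWeight r₀ R₀ s f x' y * f y) ^ (1 / 2 : ℝ) :=
        ENNReal.lintegral_mul_norm_pow_le ((hg x).mul hf).aemeasurable
        ((hg x').mul hf).aemeasurable (by norm_num) (by norm_num) (add_halves 1)
    _ ≤ (ENNReal.ofReal R₀ * circEnergy r₀ R₀ s f x) ^ (1 / 2 : ℝ) *
        (ENNReal.ofReal R₀ * circEnergy r₀ R₀ s f x') ^ (1 / 2 : ℝ) := by
        gcongr <;> exact lintegral_annulusWeight_mul_le hr₀ hs hf _
    _ = _ := by
        rw [ENNReal.mul_rpow_of_nonneg _ _ (by norm_num), ENNReal.mul_rpow_of_nonneg _ _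
          (by norm_num), ENNReal.mul_rpow_of_nonneg _ _ (by norm_num), mul_mul_mul_comm,
          ← ENNReal.rpow_add_of_nonneg _ _ (by norm_num) (by norm_num), add_halves,
          ENNReal.rpow_one]

/-- The interaction of two annular weights with centres `x ≠ x'`. -/
theorem exists_lintegral_rpow_mul_annulusWeight_le {r₀ : ℝ} (R₀ : ℝ) (hr₀ : 0 < r₀) {β : ℝ}
    (hβ : 0 < β) (hβ' : β < 1 / 2) :
    ∃ C : ℝ≥0∞, C ≠ ⊤ ∧ ∀ f : Plane → ℝ≥0∞, Measurable f → ∀ x x' : Plane, x' ≠ x →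
      ∫⁻ y, f y ^ (1 - 2 * β) * (annulusWeight r₀ R₀ ((1 + 2 * β) / (1 - β)) f x y *
          annulusWeight r₀ R₀ ((1 + 2 * β) / (1 - β)) f x' y) ≤
        C * edist x' x ^ (-β) *
          (circEnergy r₀ R₀ ((1 + 2 * β) / (1 - β)) f x ^ ((1 + β) / 2) *
            circEnergy r₀ R₀ ((1 + 2 * β) / (1 - β)) f x' ^ ((1 + β) / 2)) := by
  obtain ⟨A, hA, hAnn⟩ := exists_lintegral_annuli_le R₀ hr₀
  refine ⟨ENNReal.ofReal R₀ ^ (1 - 2 * β) * A ^ (2 * β), ENNReal.mul_ne_top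
    (ENNReal.rpow_ne_top_of_nonneg (by linarith) ENNReal.ofReal_ne_top)
    (ENNReal.rpow_ne_top_of_nonneg (by linarith) hA), ?_⟩
  intro f hf x x' hxx
  have h1β : 0 < 1 - β := by linarith
  set s := (1 + 2 * β) / (1 - β) with hs
  have hs1 : 1 ≤ s := by
    rw [hs, one_le_div h1β]
    linarith
  set b := (1 + 2 * β) / (4 * β) with hb
  have hb0 : 0 < b := by positivity
  set g := annulusWeight r₀ R₀ s f with hgdef
  set I := circEnergy r₀ R₀ s f with hI
  have hg := measurable_annulusWeight_right r₀ R₀ s hf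
  have hgb (x y : Plane) : g x y ^ b =
      (Set.Ioc r₀ R₀).indicator (fun r => (circAvg f x r ^ (s - 1)) ^ b) ‖x - y‖ := by
    rw [hgdef, annulusWeight]
    by_cases hy : ‖x - y‖ ∈ Set.Ioc r₀ R₀
    · rw [Set.indicator_of_mem hy, Set.indicator_of_mem hy]
    · rw [Set.indicator_of_notMem hy, Set.indicator_of_notMem hy, ENNReal.zero_rpow_of_pos hb0]
  have hub (x : Plane) :
      ∫⁻ r in Set.Ioc r₀ R₀, ((circAvg f x r ^ (s - 1)) ^ b) ^ (4 / 3 : ℝ) = I x := by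
    refine lintegral_congr fun r => ?_
    rw [← ENNReal.rpow_mul, ← ENNReal.rpow_mul]
    congr 1
    rw [hs, hb]
    field_simp
    ring
  have hann : ∫⁻ y, g x y ^ b * g x' y ^ b ≤
      A * edist x' x ^ (-(1 / 2) : ℝ) * (I x * I x') ^ (3 / 4 : ℝ) := by
    have := hAnn x x' hxx (fun r => (circAvg f x r ^ (s - 1)) ^ b)
      (fun r => (circAvg f x' r ^ (s - 1)) ^ b)
      (((measurable_circAvg_right hf x).pow_const _).pow_const _)
      (((measurable_circAvg_right hf x').pow_const _).pow_const _)
    simp only [hub, ← hgb] at this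
    rwa [ENNReal.mul_rpow_of_nonneg _ _ (by norm_num)]
  have hsplit (w : ℝ≥0∞) : w = (w ^ (1 / 2 : ℝ)) ^ (1 - 2 * β) * (w ^ b) ^ (2 * β) := by
    rw [← ENNReal.rpow_mul, ← ENNReal.rpow_mul,
      ← ENNReal.rpow_add_of_nonneg _ _ (by linarith) (by positivity)]
    conv_lhs => rw [← ENNReal.rpow_one w]
    congr 1
    rw [hb]
    field_simp
    ring
  calc
    _ = ∫⁻ y, (f y * (g x y ^ (1 / 2 : ℝ) * g x' y ^ (1 / 2 : ℝ))) ^ (1 - 2 * β) *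
          (g x y ^ b * g x' y ^ b) ^ (2 * β) := by
        refine lintegral_congr fun y => ?_
        rw [ENNReal.mul_rpow_of_nonneg _ _ (by linarith), ENNReal.mul_rpow_of_nonneg _ _
          (by linarith), ENNReal.mul_rpow_of_nonneg _ _ (by linarith)]
        conv_lhs => rw [hsplit (g x y), hsplit (g x' y)]
        ring
    _ ≤ (∫⁻ y, f y * (g x y ^ (1 / 2 : ℝ) * g x' y ^ (1 / 2 : ℝ))) ^ (1 - 2 * β) *
          (∫⁻ y, g x y ^ b * g x' y ^ b) ^ (2 * β) :=
        ENNReal.lintegral_mul_norm_pow_le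
          (hf.mul (((hg x).pow_const _).mul ((hg x').pow_const _))).aemeasurable
          (((hg x).pow_const _).mul ((hg x').pow_const _)).aemeasurable
          (by linarith) (by linarith) (by ring)
    _ ≤ (ENNReal.ofReal R₀ * (I x * I x') ^ (1 / 2 : ℝ)) ^ (1 - 2 * β) *
          (A * edist x' x ^ (-(1 / 2) : ℝ) * (I x * I x') ^ (3 / 4 : ℝ)) ^ (2 * β) := by
        gcongr
        · linarith
        · exact lintegral_mul_sqrt_annulusWeight_le hr₀.le hs1 hf x x'
    _ = ENNReal.ofReal R₀ ^ (1 - 2 * β) * A ^ (2 * β) * edist x' x ^ (-β) *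
          (I x * I x') ^ ((1 + β) / 2) := by
        generalize I x * I x' = z
        rw [ENNReal.mul_rpow_of_nonneg _ _ (by linarith), ENNReal.mul_rpow_of_nonneg _ _
          (by linarith), ENNReal.mul_rpow_of_nonneg _ _ (by linarith), ← ENNReal.rpow_mul,
          ← ENNReal.rpow_mul, ← ENNReal.rpow_mul, mul_mul_mul_comm,
          ← ENNReal.rpow_add_of_nonneg _ _ (by linarith) (by linarith), ← mul_assoc]
        congr 2
        · congr 1
          ring
        · ring
    _ = _ := by rw [ENNReal.mul_rpow_of_nonneg _ _ (by linarith)]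

theorem lintegral_mul_le_sqrt_mul_sqrt {X : Type*} [MeasurableSpace X] {μ : Measure X}
    {f G : X → ℝ≥0∞} (hf : Measurable f) (hG : Measurable G) {p : ℝ} (hp : 0 ≤ p) (hp' : p ≤ 2) :
    ∫⁻ y, f y * G y ∂μ ≤ (∫⁻ y, f y ^ p ∂μ) ^ (1 / 2 : ℝ) *
      (∫⁻ y, f y ^ (2 - p) * (G y * G y) ∂μ) ^ (1 / 2 : ℝ) := by
  calc
    _ = ∫⁻ y, (f y ^ p) ^ (1 / 2 : ℝ) * (f y ^ (2 - p) * (G y * G y)) ^ (1 / 2 : ℝ) ∂μ := by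
        refine lintegral_congr fun y => ?_
        rw [ENNReal.mul_rpow_of_nonneg _ _ (by norm_num), ENNReal.mul_rpow_of_nonneg _ _
          (by norm_num), ← ENNReal.rpow_add_of_nonneg _ _ (by norm_num) (by norm_num),
          add_halves, ENNReal.rpow_one, ← mul_assoc, ← ENNReal.rpow_mul, ← ENNReal.rpow_mul,
          ← ENNReal.rpow_add_of_nonneg _ _ (by linarith) (by linarith)]
        conv_lhs => rw [← ENNReal.rpow_one (f y)]
        congr 2
        ring
    _ ≤ _ := ENNReal.lintegral_mul_norm_pow_le (hf.pow_const _).aemeasurable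
        ((hf.pow_const _).mul (hG.mul hG)).aemeasurable (by norm_num) (by norm_num) (add_halves 1)

theorem lintegral_mul_lintegral_mul_lintegral {X Y : Type*} [MeasurableSpace X]
    [MeasurableSpace Y] {μ : Measure X} {ν : Measure Y} [SFinite μ] [SFinite ν]
    {φ : Y → ℝ≥0∞} (hφ : Measurable φ) {k : X → Y → ℝ≥0∞}
    (hk : Measurable (Function.uncurry k)) :
    ∫⁻ y, φ y * ((∫⁻ x, k x y ∂μ) * ∫⁻ x, k x y ∂μ) ∂ν =
      ∫⁻ x, ∫⁻ x', ∫⁻ y, φ y * (k x y * k x' y) ∂ν ∂μ ∂μ := by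
  have hk' (y : Y) : Measurable fun x => k x y := hk.comp measurable_prodMk_right
  have m₁ : Measurable fun w : Y × X × X => k w.2.1 w.1 :=
    hk.comp (measurable_snd.fst.prodMk measurable_fst)
  have m₂ : Measurable fun w : Y × X × X => k w.2.2 w.1 :=
    hk.comp (measurable_snd.snd.prodMk measurable_fst)
  have m : Measurable fun w : Y × X × X => φ w.1 * (k w.2.1 w.1 * k w.2.2 w.1) :=
    (hφ.comp measurable_fst).mul (m₁.mul m₂)
  have m' : Measurable fun z : X × X => ∫⁻ y, φ y * (k z.1 y * k z.2 y) ∂ν :=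
    m.lintegral_prod_left'
  calc
    _ = ∫⁻ y, ∫⁻ z, φ y * (k z.1 y * k z.2 y) ∂μ.prod μ ∂ν := by
        refine lintegral_congr fun y => ?_
        rw [lintegral_const_mul _ (f := fun z : X × X => k z.1 y * k z.2 y)
          (((hk' y).comp measurable_fst).mul ((hk' y).comp measurable_snd)),
          lintegral_prod_mul (hk' y).aemeasurable (hk' y).aemeasurable]
    _ = ∫⁻ z, ∫⁻ y, φ y * (k z.1 y * k z.2 y) ∂ν ∂μ.prod μ :=
        lintegral_lintegral_swap m.aemeasurable
    _ = _ := lintegral_prod _ m'.aemeasurable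

theorem circEnergy_le {r₀ R₀ s : ℝ} (hs : 0 ≤ s) {f : Plane → ℝ≥0∞} {M : ℝ≥0∞}
    (hM : ∀ y, f y ≤ M) (x : Plane) :
    circEnergy r₀ R₀ s f x ≤ (M * ENNReal.ofReal (2 * Real.pi)) ^ s * ENNReal.ofReal (R₀ - r₀) := by
  have h (r : ℝ) : circAvg f x r ≤ M * ENNReal.ofReal (2 * Real.pi) := by
    calc circAvg f x r ≤ ∫⁻ θ in Set.Ioo (-Real.pi) Real.pi, M := lintegral_mono fun θ => hM _
      _ = _ := by
        rw [setLIntegral_const, Real.volume_Ioo, sub_neg_eq_add, two_mul]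
  calc circEnergy r₀ R₀ s f x
      ≤ ∫⁻ r in Set.Ioc r₀ R₀, (M * ENNReal.ofReal (2 * Real.pi)) ^ s :=
        lintegral_mono fun r => ENNReal.rpow_le_rpow (h r) hs
    _ = _ := by rw [setLIntegral_const, Real.volume_Ioc]

/-- Mixed-norm estimate for circular averages in the range of finite exponents. -/
theorem exists_lintegral_circEnergy_rpow_le {μ : Measure Plane} [IsProbabilityMeasure μ]
    {r₀ : ℝ} (R₀ : ℝ) (hr₀ : 0 < r₀) {α θ : ℝ} (hα : 0 < α) (hα' : α < 1 / 2) (hθ : 0 < θ)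
    (hθ' : θ ≤ 1) {K : ℝ≥0∞} (hK : K ≠ ⊤) (hμK : ∀ x, ∫⁻ x', edist x' x ^ (-α) ∂μ ≤ K)
    (hμ : ∀ x, μ {x} = 0) :
    ∃ D : ℝ≥0∞, D ≠ ⊤ ∧ ∀ f : Plane → ℝ≥0∞, Measurable f → (∃ M ≠ ⊤, ∀ y, f y ≤ M) →
      (∫⁻ x, circEnergy r₀ R₀ ((1 + 2 * (α * θ)) / (1 - α * θ)) f x ^ ((1 - α * θ) / θ) ∂μ) ^
          (θ / 2) ≤ D * (∫⁻ y, f y ^ (1 + 2 * (α * θ))) ^ (1 / 2 : ℝ) := by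
  set β := α * θ with hβdef
  have hβ : 0 < β := mul_pos hα hθ
  have hβ' : β < 1 / 2 := by nlinarith
  obtain ⟨A, hA, hpair⟩ := exists_lintegral_rpow_mul_annulusWeight_le R₀ hr₀ hβ hβ'
  have hr₀' : ENNReal.ofReal r₀ ≠ 0 := by simpa using hr₀
  refine ⟨(ENNReal.ofReal r₀)⁻¹ * (A * K ^ θ) ^ (1 / 2 : ℝ), ENNReal.mul_ne_top
    (ENNReal.inv_ne_top.2 hr₀') (ENNReal.rpow_ne_top_of_nonneg (by norm_num)
    (ENNReal.mul_ne_top hA (ENNReal.rpow_ne_top_of_nonneg hθ.le hK))), ?_⟩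
  rintro f hf ⟨M, hM, hfM⟩
  have h1β : 0 < 1 - β := by linarith
  set s := (1 + 2 * β) / (1 - β) with hs
  have hs1 : 1 ≤ s := by
    rw [hs, one_le_div h1β]
    linarith
  set κ := (1 - β) / θ with hκ
  have hκ0 : 0 < κ := div_pos h1β hθ
  set I := circEnergy r₀ R₀ s f with hI
  have hIm : Measurable I := measurable_circEnergy r₀ R₀ s hf
  set B := (M * ENNReal.ofReal (2 * Real.pi)) ^ s * ENNReal.ofReal (R₀ - r₀) with hB
  have hIB (x : Plane) : I x ≤ B := circEnergy_le (by linarith) hfM x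
  have hBt : B ≠ ⊤ := ENNReal.mul_ne_top (ENNReal.rpow_ne_top_of_nonneg (by linarith)
    (ENNReal.mul_ne_top hM ENNReal.ofReal_ne_top)) ENNReal.ofReal_ne_top
  have hIt (x : Plane) : I x ≠ ⊤ := ne_top_of_le_ne_top hBt (hIB x)
  set Q := ∫⁻ x, I x ^ κ ∂μ with hQ
  have hQt : Q ≠ ⊤ := by
    refine ne_top_of_le_ne_top (ENNReal.rpow_ne_top_of_nonneg hκ0.le hBt) ?_
    calc Q ≤ ∫⁻ _, B ^ κ ∂μ := lintegral_mono fun x => ENNReal.rpow_le_rpow (hIB x) hκ0.le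
      _ = B ^ κ := by simp
  -- The weight dualizing the outer norm.
  set ρ : Plane → ℝ≥0∞ := {x | I x ≠ 0}.indicator fun x => I x ^ (κ - 1) with hρ
  have hρm : Measurable ρ :=
    (hIm.pow_const _).indicator (hIm (measurableSet_singleton 0).compl)
  have hρI (e : ℝ) (he : 0 < e) (he' : 0 < κ - 1 + e) (x : Plane) :
      ρ x * I x ^ e = I x ^ (κ - 1 + e) := by
    by_cases hx : I x = 0
    · rw [hx, ENNReal.zero_rpow_of_pos he, ENNReal.zero_rpow_of_pos he', mul_zero]
    · rw [hρ, Set.indicator_of_mem (show x ∈ {x | I x ≠ 0} from hx),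
        ENNReal.rpow_add _ _ hx (hIt x)]
  set g := annulusWeight r₀ R₀ s f with hg
  have hgm : Measurable fun z : Plane × Plane => g z.1 z.2 := measurable_annulusWeight r₀ R₀ s hf
  have hρg : Measurable fun z : Plane × Plane => ρ z.1 * g z.1 z.2 :=
    (hρm.comp measurable_fst).mul hgm
  set G : Plane → ℝ≥0∞ := fun y => ∫⁻ x, ρ x * g x y ∂μ with hG
  have hGm : Measurable G := hρg.lintegral_prod_left'
  have hρgf : Measurable fun z : Plane × Plane => ρ z.1 * (g z.1 z.2 * f z.2) :=
    (hρm.comp measurable_fst).mul (hgm.mul (hf.comp measurable_snd))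
  have hgr (x : Plane) : Measurable (g x) := measurable_annulusWeight_right r₀ R₀ s hf x
  have step₁ : ENNReal.ofReal r₀ * Q ≤ ∫⁻ y, f y * G y := by
    calc
      _ = ∫⁻ x, ρ x * (ENNReal.ofReal r₀ * I x) ∂μ := by
          rw [hQ, ← lintegral_const_mul _ (hIm.pow_const κ)]
          refine lintegral_congr fun x => ?_
          have := hρI 1 one_pos (by linarith) x
          rw [ENNReal.rpow_one, sub_add_cancel] at this
          rw [← this, mul_left_comm]
      _ ≤ ∫⁻ x, ∫⁻ y, ρ x * (g x y * f y) ∂volume ∂μ := by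
          refine lintegral_mono fun x => ?_
          rw [lintegral_const_mul _ (f := fun y => g x y * f y) ((hgr x).mul hf)]
          exact mul_le_mul_right (mul_circEnergy_le hr₀.le hs1 hf x) _
      _ = ∫⁻ y, ∫⁻ x, ρ x * (g x y * f y) ∂μ := lintegral_lintegral_swap hρgf.aemeasurable
      _ = _ := by
          refine lintegral_congr fun y => ?_
          rw [hG, ← lintegral_const_mul _ (f := fun x => ρ x * g x y)
            (hρg.comp measurable_prodMk_right)]
          refine lintegral_congr fun x => ?_
          ring
  have hexp : κ - 1 + (1 + β) / 2 = κ * (1 - θ / 2) := by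
    rw [hκ]
    field_simp
    ring
  have hexp0 : 0 < κ * (1 - θ / 2) := mul_pos hκ0 (by linarith)
  have step₂ : ∫⁻ y, f y ^ (1 - 2 * β) * (G y * G y) ≤ A * (K ^ θ * Q ^ (2 - θ)) := by
    calc
      _ = ∫⁻ x, ∫⁻ x', ∫⁻ y, f y ^ (1 - 2 * β) * (ρ x * g x y * (ρ x' * g x' y))
            ∂volume ∂μ ∂μ :=
          lintegral_mul_lintegral_mul_lintegral (hf.pow_const _) hρg
      _ ≤ ∫⁻ x, ∫⁻ x', A * ((edist x' x ^ (-α)) ^ θ *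
            ((I x ^ κ) ^ (1 - θ / 2) * (I x' ^ κ) ^ (1 - θ / 2))) ∂μ ∂μ := by
          refine lintegral_mono fun x => lintegral_mono_ae ?_
          have hne : ∀ᵐ x' ∂μ, x' ≠ x := by
            rw [ae_iff]
            simpa using hμ x
          filter_upwards [hne] with x' hx'
          calc
            _ = ρ x * ρ x' * ∫⁻ y, f y ^ (1 - 2 * β) * (g x y * g x' y) := by
                rw [← lintegral_const_mul _ (f := fun y => f y ^ (1 - 2 * β) * (g x y * g x' y))
                  ((hf.pow_const _).mul ((hgr x).mul (hgr x')))]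
                refine lintegral_congr fun y => ?_
                ring
            _ ≤ ρ x * ρ x' * (A * edist x' x ^ (-β) *
                  (I x ^ ((1 + β) / 2) * I x' ^ ((1 + β) / 2))) :=
                mul_le_mul_right (hpair f hf x x' hx') _
            _ = A * (edist x' x ^ (-β) *
                  ((ρ x * I x ^ ((1 + β) / 2)) * (ρ x' * I x' ^ ((1 + β) / 2)))) := by ring
            _ = _ := by
                rw [hρI _ (by linarith) (hexp ▸ hexp0), hρI _ (by linarith) (hexp ▸ hexp0), hexp,
                  ← ENNReal.rpow_mul, ← ENNReal.rpow_mul, ← ENNReal.rpow_mul, hβdef, neg_mul]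
      _ ≤ A * (K ^ θ * Q ^ (2 - θ)) := by
          simp only [lintegral_const_mul' A _ hA]
          refine mul_le_mul_right (lintegral_lintegral_rpow_mul_le
            (k := fun x x' => edist x' x ^ (-α)) ?_ hμK ?_ (hIm.pow_const κ) hθ hθ') _
          · exact (measurable_snd.edist measurable_fst).pow_const _
          · simpa only [edist_comm] using hμK
  set N := ∫⁻ y, f y ^ (1 + 2 * β) with hN
  have step₃ : ENNReal.ofReal r₀ * Q ≤
      N ^ (1 / 2 : ℝ) * ((A * K ^ θ) ^ (1 / 2 : ℝ) * Q ^ (1 - θ / 2)) := by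
    refine step₁.trans ((lintegral_mul_le_sqrt_mul_sqrt hf hGm (p := 1 + 2 * β)
      (by linarith) (by linarith)).trans ?_)
    rw [show 2 - (1 + 2 * β) = 1 - 2 * β by ring]
    refine mul_le_mul_right ((ENNReal.rpow_le_rpow step₂ (by norm_num)).trans_eq ?_) _
    rw [← mul_assoc, ENNReal.mul_rpow_of_nonneg _ _ (by norm_num), ← ENNReal.rpow_mul]
    congr 2
    ring
  rcases eq_or_ne Q 0 with hQ0 | hQ0
  · rw [hQ0, ENNReal.zero_rpow_of_pos (by positivity)]
    exact zero_le
  have hQe : Q = Q ^ (θ / 2) * Q ^ (1 - θ / 2) := by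
    rw [← ENNReal.rpow_add _ _ hQ0 hQt, add_sub_cancel, ENNReal.rpow_one]
  have hQ1 : Q ^ (1 - θ / 2) ≠ 0 := by
    rw [Ne, ENNReal.rpow_eq_zero_iff_of_pos (by linarith)]
    exact hQ0
  have hQ2 : Q ^ (1 - θ / 2) ≠ ⊤ := ENNReal.rpow_ne_top_of_nonneg (by linarith) hQt
  have step₄ : ENNReal.ofReal r₀ * Q ^ (θ / 2) ≤ (A * K ^ θ) ^ (1 / 2 : ℝ) * N ^ (1 / 2 : ℝ) := by
    refine (ENNReal.mul_le_mul_iff_left hQ1 hQ2).1 ?_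
    calc _ = ENNReal.ofReal r₀ * (Q ^ (θ / 2) * Q ^ (1 - θ / 2)) := mul_assoc _ _ _
      _ ≤ _ := by
        rw [← hQe]
        refine step₃.trans_eq ?_
        ring
  rw [mul_assoc, ← ENNReal.div_eq_inv_mul, ENNReal.le_div_iff_mul_le (Or.inl hr₀')
    (Or.inl ENNReal.ofReal_ne_top), mul_comm]
  exact step₄

theorem enorm_radial_norm_le {r₀ R₀ s : ℝ} (hr : r₀ ≤ R₀) (hs : 0 < s) {f : Plane → ℝ}
    (hf : Measurable f) (x : Plane) :
    ‖(∫ r in r₀..R₀, |sphAvg f x r| ^ s) ^ (1 / s)‖ₑ ≤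
      circEnergy r₀ R₀ s (fun y => ‖f y‖ₑ) x ^ (1 / s) := by
  have h0 : 0 ≤ ∫ r in r₀..R₀, |sphAvg f x r| ^ s :=
    intervalIntegral.integral_nonneg hr fun r _ => Real.rpow_nonneg (abs_nonneg _) _
  rw [Real.enorm_rpow_of_nonneg h0 (by positivity)]
  refine ENNReal.rpow_le_rpow ?_ (by positivity)
  rw [intervalIntegral.integral_of_le hr]
  refine (enorm_integral_le_lintegral_enorm _).trans (lintegral_mono fun r => ?_)
  rw [Real.enorm_rpow_of_nonneg (abs_nonneg _) hs.le, Real.enorm_abs]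
  exact ENNReal.rpow_le_rpow (enorm_sphAvg_le hf x r) hs.le

theorem circEnergy_one_le {r₀ : ℝ} (R₀ : ℝ) (hr₀ : 0 < r₀) {f : Plane → ℝ≥0∞}
    (hf : Measurable f) (x : Plane) :
    circEnergy r₀ R₀ 1 f x ≤ (ENNReal.ofReal r₀)⁻¹ * ∫⁻ y, f y := by
  rw [← ENNReal.div_eq_inv_mul, ENNReal.le_div_iff_mul_le
    (Or.inl (ENNReal.ofReal_pos.2 hr₀).ne') (Or.inl ENNReal.ofReal_ne_top), mul_comm]
  refine (mul_circEnergy_le hr₀.le le_rfl hf x).trans (lintegral_mono fun y => ?_)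
  refine mul_le_of_le_one_left zero_le ?_
  refine Set.indicator_apply_le' (fun _ => ?_) fun _ => zero_le_one
  rw [sub_self, ENNReal.rpow_zero]

theorem eLpNorm_top_radial_norm_le (μ : Measure Plane) {r₀ R₀ : ℝ} (hr₀ : 0 < r₀) (hr : r₀ ≤ R₀)
    {f : Plane → ℝ} (hf : Measurable f) :
    eLpNorm (fun x => (∫ r in r₀..R₀, |sphAvg f x r| ^ (1 : ℝ)) ^ (1 / (1 : ℝ))) ⊤ μ ≤
      (ENNReal.ofReal r₀)⁻¹ * eLpNorm f 1 volume := by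
  rw [eLpNorm_exponent_top, eLpNorm_one_eq_lintegral_enorm]
  refine eLpNormEssSup_le_of_ae_enorm_bound (Filter.Eventually.of_forall fun x => ?_)
  refine (enorm_radial_norm_le hr one_pos hf x).trans ?_
  rw [div_one, ENNReal.rpow_one]
  exact circEnergy_one_le R₀ hr₀ hf.enorm x

/-- The mixed-norm estimate for finite outer exponent `(1 + 2αθ) / θ`. -/
theorem exists_eLpNorm_radial_norm_le {μ : Measure Plane} [IsProbabilityMeasure μ]
    {r₀ R₀ : ℝ} (hr₀ : 0 < r₀) (hr : r₀ ≤ R₀) {α α' C θ : ℝ} (hα : 0 < α) (hαα' : α < α')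
    (hα' : α < 1 / 2) (hθ : 0 < θ) (hθ' : θ ≤ 1)
    (hμ : ∀ (x : Plane) (δ : ℝ), 0 < δ → μ (ball x δ) ≤ ENNReal.ofReal (C * δ ^ α')) :
    ∃ E : ℝ≥0∞, E ≠ ⊤ ∧ ∀ f : Plane → ℝ, Measurable f → (∃ M, ∀ x, |f x| ≤ M) →
      eLpNorm (fun x => (∫ r in r₀..R₀, |sphAvg f x r| ^ ((1 + 2 * (α * θ)) / (1 - α * θ))) ^
          (1 / ((1 + 2 * (α * θ)) / (1 - α * θ)))) (ENNReal.ofReal ((1 + 2 * (α * θ)) / θ)) μ ≤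
        E * eLpNorm f (ENNReal.ofReal (1 + 2 * (α * θ))) volume := by
  obtain ⟨K, hK, hμK⟩ := exists_lintegral_edist_rpow_neg_le hα hαα' hμ
  obtain ⟨D, hD, hest⟩ := exists_lintegral_circEnergy_rpow_le R₀ hr₀ hα hα' hθ hθ' hK hμK
    (measure_singleton_eq_zero_of_ball_le (hα.trans hαα') hμ)
  set β := α * θ with hβdef
  have hβ : 0 < β := mul_pos hα hθ
  have hβ' : β < 1 / 2 := by nlinarith
  have h1β : 0 < 1 - β := by linarith
  set p := 1 + 2 * β with hp
  have hp0 : 0 < p := by linarith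
  set s := p / (1 - β) with hs
  have hs0 : 0 < s := div_pos hp0 h1β
  set q := p / θ with hq
  have hq0 : 0 < q := div_pos hp0 hθ
  refine ⟨D ^ (2 / p), ENNReal.rpow_ne_top_of_nonneg (by positivity) hD, ?_⟩
  rintro f hf ⟨M, hfM⟩
  have hb := hest (fun y => ‖f y‖ₑ) hf.enorm ⟨ENNReal.ofReal M, ENNReal.ofReal_ne_top, fun y => by
    rw [Real.enorm_eq_ofReal_abs]
    exact ENNReal.ofReal_le_ofReal (hfM y)⟩
  rw [eLpNorm_eq_lintegral_rpow_enorm_toReal (ENNReal.ofReal_pos.2 hq0).ne' ENNReal.ofReal_ne_top,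
    eLpNorm_eq_lintegral_rpow_enorm_toReal (ENNReal.ofReal_pos.2 hp0).ne' ENNReal.ofReal_ne_top,
    ENNReal.toReal_ofReal hq0.le, ENNReal.toReal_ofReal hp0.le]
  set I := circEnergy r₀ R₀ s fun y => ‖f y‖ₑ
  calc
    _ ≤ (∫⁻ x, I x ^ ((1 - β) / θ) ∂μ) ^ (1 / q) := by
        refine ENNReal.rpow_le_rpow (lintegral_mono fun x => ?_) (by positivity)
        refine (ENNReal.rpow_le_rpow (enorm_radial_norm_le hr hs0 hf x) hq0.le).trans_eq ?_
        rw [← ENNReal.rpow_mul]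
        congr 1
        rw [hs, hq]
        field_simp
    _ = ((∫⁻ x, I x ^ ((1 - β) / θ) ∂μ) ^ (θ / 2)) ^ (2 / p) := by
        rw [← ENNReal.rpow_mul]
        congr 1
        rw [hq]
        field_simp
    _ ≤ (D * (∫⁻ y, ‖f y‖ₑ ^ p) ^ (1 / 2 : ℝ)) ^ (2 / p) :=
        ENNReal.rpow_le_rpow hb (by positivity)
    _ = _ := by
        rw [ENNReal.mul_rpow_of_nonneg _ _ (by positivity), ← ENNReal.rpow_mul]
        congr 2
        field_simp

/-- Theorem 3(b): mixed-norm estimate for the circular averaging operator relative to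
a measure `λ` on `ℝ²` with `λ(B(x,δ)) ≤ C δ^{α'}`, `0 < α < α' < 1/2`, at the exponents
`(1/p, 1/q, 1/s) = t(1/(1+2α), 1/(1+2α), (1-α)/(1+2α)) + (1-t)(1, 0, 1)`, `0 ≤ t < 1`. -/
theorem stmt_6 (lam : Measure (EuclideanSpace ℝ (Fin 2))) [IsProbabilityMeasure lam]
    (hcomp : ∃ K : Set (EuclideanSpace ℝ (Fin 2)), IsCompact K ∧ lam Kᶜ = 0)
    (α α' C : ℝ) (hα0 : 0 < α) (hαα' : α < α') (hα' : α' < 1 / 2)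
    (hfrost : ∀ (x : EuclideanSpace ℝ (Fin 2)) (δ : ℝ), 0 < δ →
      lam (Metric.ball x δ) ≤ ENNReal.ofReal (C * δ ^ α'))
    (r0 R0 : ℝ) (hr0 : 0 < r0) (hR0 : r0 < R0) (t : ℝ) (ht0 : 0 ≤ t) (ht1 : t < 1)
    (p s : ℝ) (q : ℝ≥0∞)
    (hp : 1 / p = t * (1 / (1 + 2 * α)) + (1 - t) * 1)
    (hq : q⁻¹ = ENNReal.ofReal (t * (1 / (1 + 2 * α))))
    (hs : 1 / s = t * ((1 - α) / (1 + 2 * α)) + (1 - t) * 1) :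
    ∃ C' > 0, ∀ f : EuclideanSpace ℝ (Fin 2) → ℝ, Measurable f →
      (∃ M, ∀ x, |f x| ≤ M) → HasCompactSupport f →
      eLpNorm (fun x => (∫ r in r0..R0, |sphAvg f x r| ^ s) ^ (1 / s)) q lam
        ≤ ENNReal.ofReal C' * eLpNorm f (ENNReal.ofReal p) volume := by
  suffices h : ∃ E : ℝ≥0∞, E ≠ ⊤ ∧ ∀ f : EuclideanSpace ℝ (Fin 2) → ℝ, Measurable f →
      (∃ M, ∀ x, |f x| ≤ M) →
      eLpNorm (fun x => (∫ r in r0..R0, |sphAvg f x r| ^ s) ^ (1 / s)) q lam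
        ≤ E * eLpNorm f (ENNReal.ofReal p) volume by
    obtain ⟨E, hE, h⟩ := h
    refine ⟨E.toReal + 1, by positivity, fun f hf hM _ => (h f hf hM).trans ?_⟩
    refine mul_le_mul_left ?_ _
    rw [ENNReal.le_ofReal_iff_toReal_le hE (by positivity)]
    linarith
  rcases ht0.eq_or_lt with rfl | ht
  · have hp1 : p = 1 := by simpa using hp
    have hs1 : s = 1 := by simpa using hs
    have hqt : q = ⊤ := by simpa using hq
    subst hp1 hs1 hqt
    refine ⟨(ENNReal.ofReal r0)⁻¹, ENNReal.inv_ne_top.2 (ENNReal.ofReal_pos.2 hr0).ne',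
      fun f hf _ => ?_⟩
    rw [ENNReal.ofReal_one]
    exact eLpNorm_top_radial_norm_le lam hr0 hR0.le hf
  · have h1t : 0 < 1 - t := by linarith
    set S := t + (1 - t) * (1 + 2 * α) with hS
    have hS0 : 0 < S := by positivity
    have hαt : 0 < S - α * t := by
      rw [hS]
      nlinarith
    have hθ : 0 < t / S := div_pos ht hS0
    have hθ1 : t / S ≤ 1 := by
      rw [div_le_one hS0, hS]
      linarith [mul_pos h1t (show 0 < 1 + 2 * α by linarith)]
    have hp' : p = 1 + 2 * (α * (t / S)) := by
      rw [← one_div_one_div p, hp]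
      have e : t * (1 / (1 + 2 * α)) + (1 - t) * 1 = S / (1 + 2 * α) := by
        rw [hS]
        field_simp
      rw [e, one_div_div]
      field_simp
      rw [hS]
      ring
    have hs' : s = (1 + 2 * (α * (t / S))) / (1 - α * (t / S)) := by
      have e₁ : t * ((1 - α) / (1 + 2 * α)) + (1 - t) * 1 = (S - α * t) / (1 + 2 * α) := by
        rw [hS]
        field_simp
        ring
      have e₂ : 1 - α * (t / S) = (S - α * t) / S := by field_simp
      have e₃ : 1 + 2 * (α * (t / S)) = (1 + 2 * α) / S := by
        field_simp
        rw [hS]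
        ring
      rw [← one_div_one_div s, hs, e₁, e₂, e₃, one_div_div, div_div_div_cancel_right₀ hS0.ne']
    have hq' : q = ENNReal.ofReal ((1 + 2 * (α * (t / S))) / (t / S)) := by
      rw [← inv_inv q, hq, ← ENNReal.ofReal_inv_of_pos (by positivity)]
      congr 1
      field_simp
      rw [hS]
      ring
    rw [hs', hq', hp']
    exact exists_eLpNorm_radial_norm_le hr0 hR0.le hα0 hαα' (hαα'.trans hα') hθ hθ1 hfrost
end

section
/- Let 0 < r_0 < R_0 < ∞ and M > 0. There is a constant C (depending on r_0, R_0, M) such that the following holds: for any distinct points x_1, x_2 ∈ ℝ² with |x_1 − x_2| ≤ M, any B > 0, and any Borel sets T_1, T_2 ⊂ [r_0, R_0] with Lebesgue measure |T_i| ≤ 2B (i = 1,2), the planar Lebesgue measure of the set {y ∈ ℝ² : |y − x_1| ∈ T_1 and |y − x_2| ∈ T_2} is at most C B^{3/2} / |x_1 − x_2|^{1/2}. -/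
open MeasureTheory Metric

/-- The third side of a triangle with sides `r`, `d` enclosing the angle `θ`. -/
noncomputable def thirdSide (r d θ : ℝ) : ℝ :=
  √(r ^ 2 + d ^ 2 - 2 * r * d * Real.cos θ)

lemma thirdSide_nonneg (r d θ : ℝ) : 0 ≤ thirdSide r d θ := Real.sqrt_nonneg _

lemma thirdSide_neg (r d θ : ℝ) : thirdSide r d (-θ) = thirdSide r d θ := by
  simp [thirdSide]

lemma sq_thirdSide (r d θ : ℝ) :
    thirdSide r d θ ^ 2 = r ^ 2 + d ^ 2 - 2 * r * d * Real.cos θ := by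
  refine Real.sq_sqrt ?_
  nlinarith [sq_nonneg (r - d * Real.cos θ), sq_nonneg (d * Real.sin θ),
    Real.sin_sq_add_cos_sq θ]

lemma continuous_thirdSide (d : ℝ) : Continuous fun p : ℝ × ℝ => thirdSide p.1 d p.2 := by
  unfold thirdSide
  fun_prop

lemma norm_polarCoord_symm_sub (p : ℝ × ℝ) (d : ℝ) :
    ‖Complex.polarCoord.symm p - (d : ℂ)‖ = thirdSide p.1 d p.2 := by
  rw [Complex.norm_def, thirdSide, Complex.polarCoord_symm_apply, Complex.normSq_apply]
  congr 1
  simp only [Complex.sub_re, Complex.mul_re, Complex.ofReal_re, Complex.add_re, Complex.I_re,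
    Complex.ofReal_im, Complex.I_im, Complex.add_im, Complex.mul_im, Complex.sub_im]
  linear_combination p.1 ^ 2 * Real.sin_sq_add_cos_sq p.2

/-- A set on which `h` expands distances by at least `1 / K` has measure at most `K` times that of
its image. -/
lemma volume_le_mul_volume_image {h : ℝ → ℝ} {S : Set ℝ} (K : NNReal)
    (hS : ∀ x ∈ S, ∀ y ∈ S, dist x y ≤ K * dist (h x) (h y)) :
    volume S ≤ K * volume (h '' S) := by
  have hinj : S.InjOn h := fun x hx y hy hxy => by
    have := hS x hx y hy
    rw [hxy, dist_self, mul_zero] at this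
    exact dist_le_zero.1 this
  have hleft : S.LeftInvOn (Function.invFunOn h S) h := hinj.leftInvOn_invFunOn
  have hlip : LipschitzOnWith K (Function.invFunOn h S) (h '' S) := by
    refine LipschitzOnWith.of_dist_le_mul ?_
    rintro _ ⟨x, hx, rfl⟩ _ ⟨y, hy, rfl⟩
    rw [hleft hx, hleft hy]
    exact hS x hx y hy
  have := hlip.hausdorffMeasure_image_le zero_le_one
  rwa [hleft.image_image, hausdorffMeasure_real, ENNReal.rpow_one] at this

lemma two_div_pi_mul_le_sin {δ m : ℝ} (hδ : 0 ≤ δ) (h1 : δ ≤ m) (h2 : m ≤ Real.pi - δ) :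
    2 / Real.pi * δ ≤ Real.sin m := by
  rcases le_total m (Real.pi / 2) with hm | hm
  · exact (by gcongr : 2 / Real.pi * δ ≤ 2 / Real.pi * m).trans
      (Real.mul_le_sin (hδ.trans h1) hm)
  · rw [← Real.sin_pi_sub]
    exact (by gcongr; linarith : 2 / Real.pi * δ ≤ 2 / Real.pi * (Real.pi - m)).trans
      (Real.mul_le_sin (by linarith) (by linarith))

/-- Away from collinear configurations, the angle is a Lipschitz function of the third side. -/
lemma sub_le_mul_thirdSide_sub {r0 R0 r d δ x y : ℝ} (hr0 : 0 < r0) (hr : r0 ≤ r) (hd : 0 < d)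
    (hδ : 0 < δ) (hx : δ ≤ x) (hxy : x ≤ y) (hy : y ≤ Real.pi - δ)
    (hxR : thirdSide r d x ≤ R0) (hyR : thirdSide r d y ≤ R0) :
    y - x ≤ Real.pi ^ 2 * R0 / (4 * r0 * d * δ) * |thirdSide r d y - thirdSide r d x| := by
  have hpi := Real.pi_pos
  have hm : 2 / Real.pi * δ ≤ Real.sin ((x + y) / 2) :=
    two_div_pi_mul_le_sin hδ.le (by linarith) (by linarith)
  have hh : 2 / Real.pi * ((y - x) / 2) ≤ Real.sin ((y - x) / 2) :=
    Real.mul_le_sin (by linarith) (by linarith)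
  have hsq : thirdSide r d y ^ 2 - thirdSide r d x ^ 2 =
      4 * r * d * (Real.sin ((x + y) / 2) * Real.sin ((y - x) / 2)) := by
    have h := Real.cos_sub_cos x y
    rw [show (x - y) / 2 = -((y - x) / 2) by ring, Real.sin_neg] at h
    rw [sq_thirdSide, sq_thirdSide]
    linear_combination 2 * r * d * h
  have hlow : 4 * r0 * d * (2 / Real.pi * δ * (2 / Real.pi * ((y - x) / 2))) ≤
      thirdSide r d y ^ 2 - thirdSide r d x ^ 2 := by
    rw [hsq]
    have : 0 ≤ (y - x) / 2 := by linarith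
    have : 0 ≤ Real.sin ((x + y) / 2) := le_trans (by positivity) hm
    have : 0 ≤ r := hr0.le.trans hr
    have : 0 ≤ 4 * r * d := by positivity
    gcongr
  have hup : thirdSide r d y ^ 2 - thirdSide r d x ^ 2 ≤
      2 * R0 * |thirdSide r d y - thirdSide r d x| := by
    have hx0 := thirdSide_nonneg r d x
    have hy0 := thirdSide_nonneg r d y
    calc thirdSide r d y ^ 2 - thirdSide r d x ^ 2
        = (thirdSide r d y + thirdSide r d x) * (thirdSide r d y - thirdSide r d x) := by ring
      _ ≤ (thirdSide r d y + thirdSide r d x) * |thirdSide r d y - thirdSide r d x| := by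
          gcongr
          exact le_abs_self _
      _ ≤ 2 * R0 * |thirdSide r d y - thirdSide r d x| := by
          gcongr
          linarith
  have key := hlow.trans hup
  rw [div_mul_eq_mul_div, le_div_iff₀ (by positivity)]
  have e : 4 * r0 * d * (2 / Real.pi * δ * (2 / Real.pi * ((y - x) / 2))) =
      8 * r0 * d * δ * (y - x) / Real.pi ^ 2 := by
    field_simp
    ring
  rw [e, div_le_iff₀ (by positivity)] at key
  linarith

lemma volume_angle_half_le {r0 R0 r d B : ℝ} (hr0 : 0 < r0) (hR0 : 0 < R0) (hr : r0 ≤ r)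
    (hd : 0 < d) (hB : 0 < B) {T : Set ℝ} (hT : T ⊆ Set.Icc r0 R0)
    (hTB : volume T ≤ ENNReal.ofReal (2 * B)) :
    volume {θ | θ ∈ Set.Icc 0 Real.pi ∧ thirdSide r d θ ∈ T} ≤
      ENNReal.ofReal ((2 + Real.pi ^ 2 * R0 / (2 * r0)) * √(B / d)) := by
  set δ := √(B / d)
  have hδ : 0 < δ := Real.sqrt_pos.2 (by positivity)
  have hδsq : δ ^ 2 = B / d := Real.sq_sqrt (by positivity)
  set S := {θ | θ ∈ Set.Icc δ (Real.pi - δ) ∧ thirdSide r d θ ∈ T}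
  set K := Real.pi ^ 2 * R0 / (4 * r0 * d * δ) with hK
  have hK0 : 0 ≤ K := by positivity
  have hS : volume S ≤ ENNReal.ofReal (K * (2 * B)) := by
    rw [ENNReal.ofReal_mul hK0]
    refine (volume_le_mul_volume_image (h := thirdSide r d) K.toNNReal ?_).trans ?_
    · intro x hx y hy
      rw [Real.coe_toNNReal _ hK0]
      have hx1 := hx.1
      have hy1 := hy.1
      rcases le_total x y with hxy | hxy
      · rw [dist_comm x, dist_comm (thirdSide r d x), Real.dist_eq, Real.dist_eq,
          abs_of_nonneg (by linarith)]
        exact sub_le_mul_thirdSide_sub hr0 hr hd hδ hx1.1 hxy hy1.2 (hT hx.2).2 (hT hy.2).2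
      · rw [Real.dist_eq, Real.dist_eq, abs_of_nonneg (by linarith)]
        exact sub_le_mul_thirdSide_sub hr0 hr hd hδ hy1.1 hxy hx1.2 (hT hy.2).2 (hT hx.2).2
    · refine mul_le_mul' le_rfl ((measure_mono ?_).trans hTB)
      rintro _ ⟨θ, hθ, rfl⟩
      exact hθ.2
  have hcover : {θ | θ ∈ Set.Icc 0 Real.pi ∧ thirdSide r d θ ∈ T} ⊆
      (Set.Icc 0 δ ∪ Set.Icc (Real.pi - δ) Real.pi) ∪ S := by
    rintro θ ⟨⟨h0, h1⟩, hθ⟩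
    rcases le_total θ δ with h | h
    · exact Or.inl (Or.inl ⟨h0, h⟩)
    rcases le_total (Real.pi - δ) θ with h' | h'
    · exact Or.inl (Or.inr ⟨h', h1⟩)
    · exact Or.inr ⟨⟨h, h'⟩, hθ⟩
  calc _ ≤ volume ((Set.Icc 0 δ ∪ Set.Icc (Real.pi - δ) Real.pi) ∪ S) := measure_mono hcover
    _ ≤ (volume (Set.Icc 0 δ) + volume (Set.Icc (Real.pi - δ) Real.pi)) + volume S :=
        (measure_union_le _ _).trans (by gcongr; exact measure_union_le _ _)
    _ ≤ (ENNReal.ofReal δ + ENNReal.ofReal δ) + ENNReal.ofReal (K * (2 * B)) := by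
        rw [Real.volume_Icc, Real.volume_Icc, sub_zero, sub_sub_cancel]
        gcongr
    _ = ENNReal.ofReal ((2 + Real.pi ^ 2 * R0 / (2 * r0)) * δ) := by
        rw [← ENNReal.ofReal_add hδ.le hδ.le, ← ENNReal.ofReal_add (by positivity) (by positivity)]
        congr 1
        have hBd : B = δ ^ 2 * d := by rw [hδsq]; field_simp
        rw [hK, hBd]
        field_simp
        ring

lemma volume_angle_le {r0 R0 r d B : ℝ} (hr0 : 0 < r0) (hR0 : 0 < R0) (hr : r0 ≤ r)
    (hd : 0 < d) (hB : 0 < B) {T : Set ℝ} (hT : T ⊆ Set.Icc r0 R0)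
    (hTB : volume T ≤ ENNReal.ofReal (2 * B)) :
    volume {θ | θ ∈ Set.Ioo (-Real.pi) Real.pi ∧ thirdSide r d θ ∈ T} ≤
      ENNReal.ofReal (2 * ((2 + Real.pi ^ 2 * R0 / (2 * r0)) * √(B / d))) := by
  set A := {θ | θ ∈ Set.Icc 0 Real.pi ∧ thirdSide r d θ ∈ T}
  have hA := volume_angle_half_le hr0 hR0 hr hd hB hT hTB
  have hcover : {θ | θ ∈ Set.Ioo (-Real.pi) Real.pi ∧ thirdSide r d θ ∈ T} ⊆
      A ∪ Neg.neg ⁻¹' A := by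
    rintro θ ⟨⟨h0, h1⟩, hθ⟩
    rcases le_total 0 θ with h | h
    · exact Or.inl ⟨⟨h, h1.le⟩, hθ⟩
    · exact Or.inr ⟨⟨by linarith, by linarith⟩, by rwa [thirdSide_neg]⟩
  calc _ ≤ volume (A ∪ Neg.neg ⁻¹' A) := measure_mono hcover
    _ ≤ volume A + volume (Neg.neg ⁻¹' A) := measure_union_le _ _
    _ = volume A + volume A := by rw [Set.neg_preimage, Measure.measure_neg]
    _ ≤ _ := by
      rw [two_mul, ENNReal.ofReal_add (by positivity) (by positivity)]
      gcongr

lemma volume_complex_le {r0 R0 d B : ℝ} (hr0 : 0 < r0) (hR0 : 0 < R0)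
    (hd : 0 < d) (hB : 0 < B) {T₁ T₂ : Set ℝ} (hm₁ : MeasurableSet T₁) (hm₂ : MeasurableSet T₂)
    (hT₁ : T₁ ⊆ Set.Icc r0 R0) (hT₂ : T₂ ⊆ Set.Icc r0 R0)
    (hB₁ : volume T₁ ≤ ENNReal.ofReal (2 * B)) (hB₂ : volume T₂ ≤ ENNReal.ofReal (2 * B)) :
    volume {z : ℂ | ‖z‖ ∈ T₁ ∧ ‖z - d‖ ∈ T₂} ≤
      ENNReal.ofReal (R0 * (2 * ((2 + Real.pi ^ 2 * R0 / (2 * r0)) * √(B / d)) * (2 * B))) := by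
  set E := {z : ℂ | ‖z‖ ∈ T₁ ∧ ‖z - d‖ ∈ T₂}
  set c := 2 * ((2 + Real.pi ^ 2 * R0 / (2 * r0)) * √(B / d))
  have hc0 : 0 ≤ c := by positivity
  have hEm : MeasurableSet E :=
    (measurable_norm hm₁).inter ((measurable_id.sub_const (d : ℂ)).norm hm₂)
  set N := {p : ℝ × ℝ | p.1 ∈ T₁ ∧ p.2 ∈ Set.Ioo (-Real.pi) Real.pi ∧
    thirdSide p.1 d p.2 ∈ T₂}
  have hNm : MeasurableSet N :=
    (measurable_fst hm₁).inter ((measurable_snd measurableSet_Ioo).inter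
      ((continuous_thirdSide d).measurable hm₂))
  have hNvol : volume N ≤ ENNReal.ofReal (c * (2 * B)) := by
    rw [Measure.volume_eq_prod, Measure.prod_apply hNm]
    calc ∫⁻ r, volume (Prod.mk r ⁻¹' N)
        ≤ ∫⁻ r, T₁.indicator (fun _ => ENNReal.ofReal c) r := by
          refine lintegral_mono fun r => ?_
          by_cases hr : r ∈ T₁
          · rw [Set.indicator_of_mem hr]
            exact (measure_mono fun θ hθ => hθ.2).trans
              (volume_angle_le hr0 hR0 (hT₁ hr).1 hd hB hT₂ hB₂)
          · rw [show Prod.mk r ⁻¹' N = ∅ from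
              Set.eq_empty_of_forall_notMem fun θ hθ => hr hθ.1]
            simp
      _ = ENNReal.ofReal c * volume T₁ := lintegral_indicator_const hm₁ _
      _ ≤ _ := by
          rw [ENNReal.ofReal_mul hc0]
          gcongr
  calc volume E = ∫⁻ z, E.indicator 1 z := (lintegral_indicator_one hEm).symm
    _ = ∫⁻ p in polarCoord.target,
          ENNReal.ofReal p.1 • E.indicator 1 (Complex.polarCoord.symm p) :=
        (Complex.lintegral_comp_polarCoord_symm _).symm
    _ ≤ ∫⁻ p in polarCoord.target, N.indicator (fun _ => ENNReal.ofReal R0) p := by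
        refine setLIntegral_mono' polarCoord.open_target.measurableSet fun p hp => ?_
        by_cases hpE : Complex.polarCoord.symm p ∈ E
        · have h1 : p.1 ∈ T₁ := by
            have := hpE.1
            rwa [Complex.norm_polarCoord_symm, abs_of_pos hp.1] at this
          have h2 : p ∈ N := ⟨h1, hp.2, by
            have := hpE.2
            rwa [norm_polarCoord_symm_sub] at this⟩
          rw [Set.indicator_of_mem hpE, Set.indicator_of_mem h2, Pi.one_apply, smul_eq_mul,
            mul_one]
          exact ENNReal.ofReal_le_ofReal (hT₁ h1).2
        · rw [Set.indicator_of_notMem hpE, smul_zero]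
          exact zero_le
    _ ≤ ∫⁻ p, N.indicator (fun _ => ENNReal.ofReal R0) p := setLIntegral_le_lintegral _ _
    _ = ENNReal.ofReal R0 * volume N := lintegral_indicator_const hNm _
    _ ≤ _ := by
        rw [ENNReal.ofReal_mul hR0.le]
        gcongr

/-- The plane can be identified isometrically with `ℂ` so that two given points become `0` and a
positive real. -/
lemma exists_measurePreserving_complex {x₁ x₂ : EuclideanSpace ℝ (Fin 2)} (hne : x₁ ≠ x₂) :
    ∃ Φ : ℂ ≃ᵐ EuclideanSpace ℝ (Fin 2), MeasurePreserving Φ ∧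
      (∀ z, dist (Φ z) x₁ = ‖z‖) ∧ ∀ z, dist (Φ z) x₂ = ‖z - dist x₁ x₂‖ := by
  set L := Complex.orthonormalBasisOneI.repr
  set w : ℂ := L.symm (x₂ - x₁) with hw
  have hwn : ‖w‖ = dist x₁ x₂ := by
    rw [hw, LinearIsometryEquiv.norm_map, dist_comm, dist_eq_norm]
  have hw0 : (‖w‖ : ℂ) ≠ 0 := by
    rw [hwn]
    exact_mod_cast (dist_pos.2 hne).ne'
  let a : Circle := ⟨w / ‖w‖, by
    change _ ∈ sphere (0 : ℂ) 1
    rw [mem_sphere_zero_iff_norm, norm_div, Complex.norm_real, norm_norm,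
      div_self (by exact_mod_cast hw0)]⟩
  let ψ : ℂ ≃ₗᵢ[ℝ] EuclideanSpace ℝ (Fin 2) := (rotation a).trans L
  have hψ : ψ (dist x₁ x₂ : ℂ) = x₂ - x₁ := by
    have : (a : ℂ) * (dist x₁ x₂ : ℂ) = w := by
      rw [← hwn]
      exact div_mul_cancel₀ _ hw0
    change L (rotation a _) = _
    rw [rotation_apply, this, hw, LinearIsometryEquiv.apply_symm_apply]
  refine ⟨ψ.toHomeomorph.toMeasurableEquiv.trans (MeasurableEquiv.addLeft x₁), ?_, ?_, ?_⟩
  · exact (measurePreserving_add_left volume x₁).comp ψ.measurePreserving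
  · intro z
    change dist (x₁ + ψ z) x₁ = _
    simp
  · intro z
    change dist (x₁ + ψ z) x₂ = _
    rw [dist_eq_norm, ← ψ.norm_map (z - _), map_sub, hψ]
    congr 1
    abel

/-- The two-dimensional intersection estimate: for `x_1 ≠ x_2` in `ℝ²` with
`|x_1 - x_2| ≤ M` and Borel sets `T_1, T_2 ⊂ [r_0, R_0]` of measure at most `2B`,
`|{y : |y - x_1| ∈ T_1, |y - x_2| ∈ T_2}| ≤ C B^{3/2} / |x_1 - x_2|^{1/2}`. -/
theorem stmt_11 (r0 R0 M : ℝ) (hr0 : 0 < r0) (hR0 : r0 < R0) (hM : 0 < M) :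
    ∃ C > 0, ∀ x₁ x₂ : EuclideanSpace ℝ (Fin 2), x₁ ≠ x₂ → dist x₁ x₂ ≤ M →
      ∀ B : ℝ, 0 < B → ∀ T₁ T₂ : Set ℝ, MeasurableSet T₁ → MeasurableSet T₂ →
        T₁ ⊆ Set.Icc r0 R0 → T₂ ⊆ Set.Icc r0 R0 →
        volume T₁ ≤ ENNReal.ofReal (2 * B) → volume T₂ ≤ ENNReal.ofReal (2 * B) →
        volume {y : EuclideanSpace ℝ (Fin 2) | dist y x₁ ∈ T₁ ∧ dist y x₂ ∈ T₂}
          ≤ ENNReal.ofReal (C * B ^ ((3 : ℝ) / 2) / dist x₁ x₂ ^ ((1 : ℝ) / 2)) := by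
  have hR : 0 < R0 := hr0.trans hR0
  refine ⟨4 * R0 * (2 + Real.pi ^ 2 * R0 / (2 * r0)), by positivity, ?_⟩
  intro x₁ x₂ hne _ B hB T₁ T₂ hm₁ hm₂ hT₁ hT₂ hB₁ hB₂
  obtain ⟨Φ, hΦ, h₁, h₂⟩ := exists_measurePreserving_complex hne
  rw [← hΦ.measure_preimage_equiv]
  simp only [Set.preimage_ofPred_eq, h₁, h₂]
  refine (volume_complex_le hr0 hR (dist_pos.2 hne) hB hm₁ hm₂ hT₁ hT₂ hB₁ hB₂).trans_eq ?_
  have hpow : B ^ ((3 : ℝ) / 2) = B * √B := by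
    rw [Real.sqrt_eq_rpow, ← Real.rpow_one_add' hB.le (by norm_num)]
    norm_num
  rw [hpow, ← Real.sqrt_eq_rpow, Real.sqrt_div hB.le]
  congr 1
  ring
end
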